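/- arXiv:math/0402054 — 3 statements merged into one kernel-verified Lean document; each statement's English description precedes it below -/
import Mathlib

section
/- Let T̄ be an almost complete basic tilting object in the cluster category C with complement M, let f : B → M be a minimal right add(T̄)-approximation in C, and complete f to a triangle M* → B → M → M*[1]. Then M* is indecomposable, M* is not in add(T̄), Ext¹_C(T̄ ⊕ M*, T̄ ⊕ M*) = 0, M* ≇ M, and T̄ ⊕ M* is the second complement completion of T̄ to a basic tilting object. -/
open CategoryTheory CategoryTheory.Limits CategoryTheory.Pretriangulated

/-- An object of an additive category is indecomposable. -/
def Indec {C : Type*} [Category C] [Preadditive C] [HasZeroObject C]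
    [HasBinaryBiproducts C] (X : C) : Prop :=
  ¬ IsZero X ∧ ∀ A B : C, Nonempty (X ≅ A ⊞ B) → IsZero A ∨ IsZero B

/-- An object `Z` belongs (up to isomorphism) to a set `T` of objects. -/
def MemIso {C : Type*} [Category C] (T : Set C) (Z : C) : Prop :=
  ∃ X ∈ T, Nonempty (Z ≅ X)

/-- `B` lies in `add T`: it is a finite biproduct of objects isomorphic to members of `T`. -/
def AddMem {C : Type*} [Category C] [Preadditive C] [HasFiniteBiproducts C]
    (T : Set C) (B : C) : Prop :=
  ∃ (m : ℕ) (g : Fin m → C), (∀ i, MemIso T (g i)) ∧ Nonempty (B ≅ biproduct g)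

/-- A basic exceptional object, encoded as its set of indecomposable direct summands. -/
def ExcSet {C : Type*} [Category C] [Preadditive C] [HasZeroObject C]
    [HasBinaryBiproducts C] (SC : C ⥤ C) (T : Set C) : Prop :=
  (∀ X ∈ T, Indec X) ∧
  (∀ X ∈ T, ∀ Y ∈ T, Nonempty (X ≅ Y) → X = Y) ∧
  (∀ X ∈ T, ∀ Y ∈ T, ∀ f : X ⟶ SC.obj Y, f = 0)

/-- A basic tilting object, encoded as a maximal exceptional set. -/
def TiltingSet {C : Type*} [Category C] [Preadditive C] [HasZeroObject C]
    [HasBinaryBiproducts C] (SC : C ⥤ C) (T : Set C) : Prop :=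
  ExcSet SC T ∧ ∀ T' : Set C, ExcSet SC T' → T ⊆ T' → T' = T

section Helpers

set_option linter.unusedSectionVars false
set_option linter.unusedSimpArgs false

universe v

variable {C : Type} [Category.{v} C] [HasZeroObject C] [HasShift C ℤ] [Preadditive C]
  [∀ n : ℤ, (shiftFunctor C n).Additive] [Pretriangulated C]
  [HasFiniteBiproducts C] [HasBinaryBiproducts C]

def ExtZ (X Y : C) : Prop := ∀ φ : X ⟶ Y⟦(1:ℤ)⟧, φ = 0

lemma loc_add {X : C} (h : IsLocalRing (End X)) {a b : X ⟶ X} (hab : IsIso (a + b)) :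
    IsIso a ∨ IsIso b := by
  have := IsLocalRing.isUnit_or_isUnit_of_isUnit_add (R := End X) (a := a) (b := b)
    ((isUnit_iff_isIso _).2 hab)
  exact this.imp (isUnit_iff_isIso _).1 (isUnit_iff_isIso _).1

lemma loc_sum {X : C} (hX : ¬ IsZero X) (h : IsLocalRing (End X)) {ι : Type*} (s : Finset ι)
    (a : ι → (X ⟶ X)) (hs : IsIso (∑ i ∈ s, a i)) : ∃ i, IsIso (a i) := by
  classical
  induction s using Finset.induction_on with
  | empty =>
    exfalso
    apply hX
    rw [IsZero.iff_id_eq_zero, ← IsIso.hom_inv_id (∑ i ∈ (∅ : Finset ι), a i)]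
    simp only [Finset.sum_empty, zero_comp]
  | insert i s hi ih =>
    rw [Finset.sum_insert hi] at hs
    rcases loc_add h hs with h1 | h1
    · exact ⟨i, h1⟩
    · exact ih h1

/-- a nonzero retract of a local object is isomorphic to it -/
lemma retract_iso {X M : C} (hX : IsLocalRing (End X)) (hM : ¬ IsZero M)
    (s : M ⟶ X) (r : X ⟶ M) (h : s ≫ r = 𝟙 M) : Nonempty (X ≅ M) := by
  have h1 : IsIso (r ≫ s + (𝟙 X - r ≫ s)) := by
    rw [add_sub_cancel]; infer_instance
  rcases loc_add hX h1 with h2 | h2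
  · have : r ≫ s = 𝟙 X := by
      rw [← cancel_mono (r ≫ s)]
      simp [reassoc_of% h]
    exact ⟨⟨r, s, this, h⟩⟩
  · exfalso
    apply hM
    rw [IsZero.iff_id_eq_zero]
    have h3 : r = 0 := by
      rw [← cancel_epi (𝟙 X - r ≫ s)]
      simp [h]
    rw [← h, h3, comp_zero]

lemma retract_add {T : Set C} (hT : ∀ X ∈ T, IsLocalRing (End X)) {M B : C} (hM : ¬ IsZero M)
    (hMl : IsLocalRing (End M)) (hB : AddMem T B) (s : M ⟶ B) (r : B ⟶ M) (h : IsIso (s ≫ r)) :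
    MemIso T M := by
  obtain ⟨m, g, hg, ⟨e⟩⟩ := hB
  have h1 : s ≫ r = ∑ i, (s ≫ e.hom ≫ biproduct.π g i) ≫ biproduct.ι g i ≫ e.inv ≫ r := by
    have : s ≫ r = s ≫ e.hom ≫ (𝟙 _) ≫ e.inv ≫ r := by simp
    rw [this, ← biproduct.total]
    simp only [Preadditive.sum_comp, Preadditive.comp_sum, Category.assoc]
  rw [h1] at h
  obtain ⟨i, hi⟩ := loc_sum hM hMl _ _ h
  obtain ⟨X, hXT, ⟨e'⟩⟩ := hg i
  set a := s ≫ e.hom ≫ biproduct.π g i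
  set b := biproduct.ι g i ≫ e.inv ≫ r
  obtain ⟨e2⟩ := retract_iso (hT X hXT) hM (a ≫ e'.hom) (e'.inv ≫ b ≫ inv (a ≫ b))
    (by
      have := IsIso.hom_inv_id (a ≫ b)
      rw [Category.assoc] at this
      simpa only [Category.assoc, Iso.hom_inv_id_assoc] using this)
  exact ⟨X, hXT, ⟨e2.symm⟩⟩

lemma ExtZ.iso_left {X X' Y : C} (h : ExtZ X Y) (e : X' ≅ X) : ExtZ X' Y := by
  intro φ
  rw [← cancel_epi e.inv, comp_zero]
  exact h _

lemma ExtZ.retract_left {X X' Y : C} (h : ExtZ X Y) (s : X' ⟶ X) (r : X ⟶ X') (hsr : s ≫ r = 𝟙 _) :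
    ExtZ X' Y := by
  intro φ
  rw [← Category.id_comp φ, ← hsr, Category.assoc, h (r ≫ φ), comp_zero]

lemma ExtZ.retract_right {X Y Y' : C} (h : ExtZ X Y) (s : Y' ⟶ Y) (r : Y ⟶ Y')
    (hsr : s ≫ r = 𝟙 _) : ExtZ X Y' := by
  intro φ
  rw [← Category.comp_id φ, ← CategoryTheory.Functor.map_id, ← hsr, Functor.map_comp, ← Category.assoc,
    h (φ ≫ _), zero_comp]

lemma ExtZ.iso_right {X Y Y' : C} (h : ExtZ X Y) (e : Y' ≅ Y) : ExtZ X Y' :=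
  h.retract_right e.hom e.inv (by simp)

lemma ExtZ.biprod_left {m : ℕ} {g : Fin m → C} {Y : C} (h : ∀ i, ExtZ (g i) Y) :
    ExtZ (biproduct g) Y := by
  intro φ
  apply biproduct.hom_ext'
  intro i
  rw [comp_zero]
  exact h i _

lemma ExtZ.biprod_right {m : ℕ} {g : Fin m → C} {Y : C} (h : ∀ i, ExtZ Y (g i)) :
    ExtZ Y (biproduct g) := by
  intro φ
  rw [← Category.comp_id φ, ← CategoryTheory.Functor.map_id, ← biproduct.total, CategoryTheory.Functor.map_sum,
    Preadditive.comp_sum]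
  apply Finset.sum_eq_zero
  intro i _
  rw [Functor.map_comp, ← Category.assoc, h i (φ ≫ _), zero_comp]

lemma ExtZ.add_left {T : Set C} {B Y : C} (hB : AddMem T B) (h : ∀ X ∈ T, ExtZ X Y) :
    ExtZ B Y := by
  obtain ⟨m, g, hg, ⟨e⟩⟩ := hB
  refine (ExtZ.biprod_left fun i => ?_).iso_left e
  obtain ⟨X, hX, ⟨e'⟩⟩ := hg i
  exact (h X hX).iso_left e'

lemma ExtZ.add_right {T : Set C} {B Y : C} (hB : AddMem T B) (h : ∀ X ∈ T, ExtZ Y X) :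
    ExtZ Y B := by
  obtain ⟨m, g, hg, ⟨e⟩⟩ := hB
  refine (ExtZ.biprod_right fun i => ?_).iso_right e
  obtain ⟨X, hX, ⟨e'⟩⟩ := hg i
  exact (h X hX).iso_right e'

lemma addMem_of_memIso {T : Set C} {X : C} (h : MemIso T X) : AddMem T X :=
  ⟨1, fun _ => X, fun _ => h, ⟨(biproductUniqueIso (fun _ : Fin 1 => X)).symm⟩⟩

lemma addMem_of_isZero {T : Set C} {X : C} (h : IsZero X) : AddMem T X := by
  refine ⟨0, Fin.elim0, fun i => i.elim0, ⟨h.iso ?_⟩⟩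
  rw [IsZero.iff_id_eq_zero]
  apply biproduct.hom_ext
  intro i
  exact i.elim0

lemma tx1 {X Y Z : C} {a : X ⟶ Y} {q : Y ⟶ Z} {η : Z ⟶ X⟦(1:ℤ)⟧}
    (h : Triangle.mk a q η ∈ distTriang C) {A : C} (φ : A ⟶ X⟦(1:ℤ)⟧)
    (hφ : φ ≫ a⟦(1:ℤ)⟧' = 0) : ∃ ψ : A ⟶ Z, φ = ψ ≫ η :=
  Triangle.coyoneda_exact₁ _ h φ hφ

lemma tx3 {X Y Z : C} {a : X ⟶ Y} {q : Y ⟶ Z} {η : Z ⟶ X⟦(1:ℤ)⟧}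
    (h : Triangle.mk a q η ∈ distTriang C) {A : C} (φ : A ⟶ Z)
    (hφ : φ ≫ η = 0) : ∃ ψ : A ⟶ Y, φ = ψ ≫ q :=
  Triangle.coyoneda_exact₃ _ h φ hφ

lemma ty2 {X Y Z : C} {a : X ⟶ Y} {q : Y ⟶ Z} {η : Z ⟶ X⟦(1:ℤ)⟧}
    (h : Triangle.mk a q η ∈ distTriang C) {A : C} (φ : Y ⟶ A)
    (hφ : a ≫ φ = 0) : ∃ ψ : Z ⟶ A, φ = q ≫ ψ :=
  Triangle.yoneda_exact₂ _ h φ hφ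

lemma tm1 {X Y Z X' Y' Z' : C} {a : X ⟶ Y} {q : Y ⟶ Z} {η : Z ⟶ X⟦(1:ℤ)⟧}
    (h : Triangle.mk a q η ∈ distTriang C)
    {a' : X' ⟶ Y'} {q' : Y' ⟶ Z'} {η' : Z' ⟶ X'⟦(1:ℤ)⟧}
    (h' : Triangle.mk a' q' η' ∈ distTriang C) (b : Y ⟶ Y') (c : Z ⟶ Z')
    (hc : q ≫ c = b ≫ q') : ∃ u : X ⟶ X', a ≫ b = u ≫ a' ∧ η ≫ u⟦(1:ℤ)⟧' = c ≫ η' :=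
  complete_distinguished_triangle_morphism₁ _ _ h h' b c hc

lemma tm2 {X Y Z X' Y' Z' : C} {a : X ⟶ Y} {q : Y ⟶ Z} {η : Z ⟶ X⟦(1:ℤ)⟧}
    (h : Triangle.mk a q η ∈ distTriang C)
    {a' : X' ⟶ Y'} {q' : Y' ⟶ Z'} {η' : Z' ⟶ X'⟦(1:ℤ)⟧}
    (h' : Triangle.mk a' q' η' ∈ distTriang C) (u : X ⟶ X') (c : Z ⟶ Z')
    (hc : η ≫ u⟦(1:ℤ)⟧' = c ≫ η') : ∃ b : Y ⟶ Y', a ≫ b = u ≫ a' ∧ q ≫ c = b ≫ q' :=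
  complete_distinguished_triangle_morphism₂ _ _ h h' u c hc

lemma tri_rot {X Y Z : C} {a : X ⟶ Y} {q : Y ⟶ Z} {η : Z ⟶ X⟦(1:ℤ)⟧}
    (h : Triangle.mk a q η ∈ distTriang C) :
    Triangle.mk q η (-a⟦(1:ℤ)⟧') ∈ distTriang C := rot_of_distTriang _ h

lemma tri_exact_shift₂ {X Y Z : C} {a : X ⟶ Y} {q : Y ⟶ Z} {η : Z ⟶ X⟦(1:ℤ)⟧}
    (h : Triangle.mk a q η ∈ distTriang C) {A : C} (φ : A ⟶ Y⟦(1:ℤ)⟧)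
    (hφ : φ ≫ q⟦(1:ℤ)⟧' = 0) : ∃ ψ : A ⟶ X⟦(1:ℤ)⟧, φ = ψ ≫ a⟦(1:ℤ)⟧' := by
  obtain ⟨ψ, hψ⟩ := tx3 (tri_rot (tri_rot h)) φ (by rw [Preadditive.comp_neg, hφ, neg_zero])
  refine ⟨-ψ, ?_⟩
  rw [Preadditive.neg_comp, hψ, Preadditive.comp_neg]

/-- left extension along `a` -/
lemma tri_extend {X Y Z : C} {a : X ⟶ Y} {q : Y ⟶ Z} {η : Z ⟶ X⟦(1:ℤ)⟧}
    (h : Triangle.mk a q η ∈ distTriang C) {W : C} (t : X ⟶ W)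
    (ht : η ≫ t⟦(1:ℤ)⟧' = 0) : ∃ t' : Y ⟶ W, t = a ≫ t' := by
  obtain ⟨ψ, hψ⟩ := ty2 (tri_rot (tri_rot h)) (t⟦(1:ℤ)⟧') (by
    first
      | exact ht
      | rw [Preadditive.neg_comp, ht, neg_zero])
  refine ⟨-(shiftFunctor C (1:ℤ)).preimage ψ, ?_⟩
  apply (shiftFunctor C (1:ℤ)).map_injective
  rw [hψ, Functor.map_comp, Functor.map_neg, Functor.map_preimage, Preadditive.comp_neg,
    Preadditive.neg_comp]

lemma mkHom_iso₁ {X Y Z X' Y' Z' : C} {a : X ⟶ Y} {q : Y ⟶ Z} {η : Z ⟶ X⟦(1:ℤ)⟧}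
    (h : Triangle.mk a q η ∈ distTriang C)
    {a' : X' ⟶ Y'} {q' : Y' ⟶ Z'} {η' : Z' ⟶ X'⟦(1:ℤ)⟧}
    (h' : Triangle.mk a' q' η' ∈ distTriang C)
    (u : X ⟶ X') (v : Y ⟶ Y') (w : Z ⟶ Z') (h1 : a ≫ v = u ≫ a') (h2 : q ≫ w = v ≫ q')
    (h3 : η ≫ u⟦(1:ℤ)⟧' = w ≫ η') (hv : IsIso v) (hw : IsIso w) : IsIso u :=
  isIso₁_of_isIso₂₃ (T := Triangle.mk a q η) (T' := Triangle.mk a' q' η')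
    { hom₁ := u, hom₂ := v, hom₃ := w, comm₁ := h1, comm₂ := h2, comm₃ := h3 } h h' hv hw

/-- existence of generators with minimality -/
lemma min_gen {k : Type} [Field k] [Linear k C] {M N : C} [FiniteDimensional k (M ⟶ N)] :
    ∃ (n : ℕ) (η : Fin n → (M ⟶ N)),
      (∀ φ : M ⟶ N, ∃ c : Fin n → (M ⟶ M), φ = ∑ i, c i ≫ η i) ∧
      ∀ s : Fin n → (M ⟶ M), ∑ i, s i ≫ η i = 0 → ∀ j, ¬ IsIso (s j) := by
  classical
  have hex : ∃ n : ℕ, ∃ (η : Fin n → (M ⟶ N)),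
      (∀ φ : M ⟶ N, ∃ c : Fin n → (M ⟶ M), φ = ∑ i, c i ≫ η i) := by
    refine ⟨_, Module.finBasis k (M ⟶ N), fun φ =>
      ⟨fun i => (Module.finBasis k (M ⟶ N)).repr φ i • 𝟙 M, ?_⟩⟩
    simp only [Linear.smul_comp, Category.id_comp]
    exact ((Module.finBasis k (M ⟶ N)).sum_repr φ).symm
  obtain ⟨η, hη⟩ := Nat.find_spec hex
  refine ⟨_, η, hη, ?_⟩
  intro s hs j hj
  have hmin := fun m hm => Nat.find_min hex (m := m) hm
  generalize Nat.find hex = n at *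
  cases n with
  | zero => exact j.elim0
  | succ n =>
    apply hmin n (Nat.lt_succ_self n)
    refine ⟨fun i => η (j.succAbove i), fun φ => ?_⟩
    obtain ⟨c, hc⟩ := hη φ
    refine ⟨fun i => c (j.succAbove i) - c j ≫ inv (s j) ≫ s (j.succAbove i), ?_⟩
    rw [Fin.sum_univ_succAbove _ j] at hs hc
    have h2 : η j = - inv (s j) ≫ ∑ i, s (j.succAbove i) ≫ η (j.succAbove i) := by
      rw [← cancel_epi (s j)]
      simp only [Preadditive.comp_neg, Preadditive.neg_comp, IsIso.hom_inv_id_assoc]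
      exact eq_neg_of_add_eq_zero_left hs
    rw [hc, h2]
    simp only [Preadditive.sub_comp, Finset.sum_sub_distrib, Preadditive.comp_sum,
      Preadditive.neg_comp, Preadditive.comp_neg, Category.assoc]
    abel

lemma finrank_lt {k : Type} [Field k] [Linear k C] [∀ X Y : C, FiniteDimensional k (X ⟶ Y)]
    {Z A B : C} (e : Z ≅ A ⊞ B) (hB : ¬ IsZero B) :
    Module.finrank k (A ⟶ A) < Module.finrank k (Z ⟶ Z) := by
  let ψ : ((A ⟶ A) × (B ⟶ B)) →ₗ[k] (Z ⟶ Z) :=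
    { toFun := fun p => e.hom ≫ (biprod.fst ≫ p.1 ≫ biprod.inl + biprod.snd ≫ p.2 ≫ biprod.inr)
        ≫ e.inv
      map_add' := fun p q => by simp; abel
      map_smul' := fun c p => by simp }
  have hψ : Function.Injective ψ := by
    rw [← LinearMap.ker_eq_bot, LinearMap.ker_eq_bot']
    rintro ⟨p, q⟩ h
    have h' : e.hom ≫ (biprod.fst ≫ p ≫ biprod.inl + biprod.snd ≫ q ≫ biprod.inr)
        ≫ e.inv = 0 := h
    have h2 : biprod.fst ≫ p ≫ biprod.inl + biprod.snd ≫ q ≫ biprod.inr = (0 : A ⊞ B ⟶ A ⊞ B) := by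
      rw [← cancel_epi e.hom, ← cancel_mono e.inv]
      simpa using h'
    have h3 := congrArg (fun t => biprod.inl ≫ t ≫ biprod.fst) h2
    have h4 := congrArg (fun t => biprod.inr ≫ t ≫ biprod.snd) h2
    simp at h3 h4
    simp [h3, h4]
  have h1 := LinearMap.finrank_le_finrank_of_injective hψ
  rw [Module.finrank_prod] at h1
  have : 0 < Module.finrank k (B ⟶ B) := by
    have : Nontrivial (B ⟶ B) := ⟨𝟙 B, 0, fun h => hB ((IsZero.iff_id_eq_zero _).2 h)⟩
    exact Module.finrank_pos
  omega

/-- induction over decompositions -/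
lemma decomp_induction (k : Type) [Field k] [Linear k C]
    [∀ X Y : C, FiniteDimensional k (X ⟶ Y)] (P : C → Prop)
    (h0 : ∀ Z, IsZero Z → P Z) (h1 : ∀ Z, Indec Z → P Z)
    (h2 : ∀ Z A B : C, (Z ≅ A ⊞ B) → P A → P B → P Z) : ∀ Z, P Z := by
  have : ∀ (n : ℕ) (Z : C), Module.finrank k (Z ⟶ Z) = n → P Z := by
    intro n
    induction n using Nat.strong_induction_on with
    | _ n ih =>
      intro Z hZ
      by_cases hz : IsZero Z
      · exact h0 Z hz
      by_cases hi : Indec Z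
      · exact h1 Z hi
      have : ∃ A B : C, Nonempty (Z ≅ A ⊞ B) ∧ ¬ IsZero A ∧ ¬ IsZero B := by
        by_contra hcon
        apply hi
        refine ⟨hz, fun A B h => ?_⟩
        by_contra h'
        rw [not_or] at h'
        exact hcon ⟨A, B, h, h'⟩
      obtain ⟨A, B, ⟨e⟩, hA, hB⟩ := this
      refine h2 Z A B e (ih _ ?_ A rfl) (ih _ ?_ B rfl)
      · rw [← hZ]; exact finrank_lt e hB
      · rw [← hZ]; exact finrank_lt (e ≪≫ biprod.braiding A B) hA
  exact fun Z => this _ Z rfl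

/-- Every object compatible with `T ∪ {M}` without `M` as a summand behaves like `add T`. -/
lemma factor_of_compat (k : Type) [Field k] [Linear k C]
    [∀ X Y : C, FiniteDimensional k (X ⟶ Y)] {T : Set C} {M B : C} (f : B ⟶ M)
    (happrox : ∀ X : C, AddMem T X → ∀ h : X ⟶ M, ∃ t : X ⟶ B, t ≫ f = h)
    (hmem : ∀ Z : C, Indec Z → ExtZ Z Z → (∀ Y ∈ insert M T, ExtZ Z Y ∧ ExtZ Y Z) →
      MemIso (insert M T) Z) :
    ∀ E : C, ExtZ E E → (∀ Y ∈ insert M T, ExtZ E Y ∧ ExtZ Y E) →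
      (∀ (s : M ⟶ E) (r : E ⟶ M), s ≫ r ≠ 𝟙 M) → ∀ h : E ⟶ M, ∃ t : E ⟶ B, t ≫ f = h := by
  refine decomp_induction k _ ?_ ?_ ?_
  · intro Z hZ _ _ _ h
    exact ⟨0, hZ.eq_of_src _ _⟩
  · intro Z hZ h1 h2 h3 h
    obtain ⟨X, hX, ⟨e⟩⟩ := hmem Z hZ h1 h2
    rcases hX with rfl | hX
    · exact absurd (e.inv_hom_id) (h3 e.inv e.hom)
    · exact happrox Z (addMem_of_memIso ⟨X, hX, ⟨e⟩⟩) h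
  · intro Z A A' e hA hA' h1 h2 h3 h
    have key : ∀ (W : C) (i : W ⟶ Z) (p : Z ⟶ W), i ≫ p = 𝟙 W →
        ExtZ W W ∧ (∀ Y ∈ insert M T, ExtZ W Y ∧ ExtZ Y W) ∧
        (∀ (s : M ⟶ W) (r : W ⟶ M), s ≫ r ≠ 𝟙 M) := by
      intro W i p hip
      refine ⟨(h1.retract_left i p hip).retract_right i p hip,
        fun Y hY => ⟨(h2 Y hY).1.retract_left i p hip, (h2 Y hY).2.retract_right i p hip⟩, ?_⟩
      intro s r hsr
      apply h3 (s ≫ i) (p ≫ r)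
      rw [Category.assoc, reassoc_of% hip, hsr]
    obtain ⟨a1, a2, a3⟩ := key A (biprod.inl ≫ e.inv) (e.hom ≫ biprod.fst) (by simp)
    obtain ⟨b1, b2, b3⟩ := key A' (biprod.inr ≫ e.inv) (e.hom ≫ biprod.snd) (by simp)
    obtain ⟨t1, ht1⟩ := hA a1 a2 a3 (biprod.inl ≫ e.inv ≫ h)
    obtain ⟨t2, ht2⟩ := hA' b1 b2 b3 (biprod.inr ≫ e.inv ≫ h)
    refine ⟨e.hom ≫ biprod.desc t1 t2, ?_⟩
    rw [← cancel_epi e.inv]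
    apply biprod.hom_ext' <;> simp [ht1, ht2]

end Helpers

/-- Let `T̄` be an almost complete basic tilting object in the cluster
category `C` with complement `M`, let `f : B → M` be a minimal right `add T̄`-approximation
in `C`, and complete `f` to a triangle `M* → B → M → M*[1]`.  Then `M*` is indecomposable,
`M*` is not in `add T̄`, `Ext¹_C(T̄ ⊕ M*, T̄ ⊕ M*) = 0`, `M* ≇ M`, and `T̄ ⊕ M*` is the
second completion of `T̄` to a basic tilting object. -/
theorem complement_via_approximation
    (k : Type) [Field k]
    -- the cluster category C: a k-linear Hom-finite pretriangulated category:
    (C : Type) [Category C] [HasZeroObject C] [HasShift C ℤ] [Preadditive C]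
    [∀ n : ℤ, (shiftFunctor C n).Additive] [Pretriangulated C]
    [Linear k C] [HasFiniteBiproducts C] [HasBinaryBiproducts C]
    [∀ X Y : C, FiniteDimensional k (X ⟶ Y)]
    -- C is Krull–Schmidt:
    (hKS : ∀ X : C, Indec X → IsLocalRing (End X))
    -- Ext¹ is symmetric in C:
    (extSym : ∀ X Y : C, (X ⟶ Y⟦(1:ℤ)⟧) ≃ₗ[k] (Y ⟶ X⟦(1:ℤ)⟧))
    -- T̄ is an almost complete basic tilting object with complement M:
    (Tbar : Set C) (hTbar : ExcSet (shiftFunctor C (1:ℤ)) Tbar)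
    (M : C) (hM : Indec M) (hMnotin : ¬ MemIso Tbar M)
    (hMcompl : TiltingSet (shiftFunctor C (1:ℤ)) (insert M Tbar))
    -- f : B ⟶ M is a minimal right add T̄-approximation of M in C:
    (B : C) (f : B ⟶ M) (hBadd : AddMem Tbar B)
    (happrox : ∀ X : C, AddMem Tbar X → ∀ h : X ⟶ M, ∃ t : X ⟶ B, t ≫ f = h)
    (hmin : ∀ g : B ⟶ B, g ≫ f = f → IsIso g)
    -- the completion of f to a triangle M* → B → M → M*[1]:
    (Mstar : C) (g : Mstar ⟶ B) (δ : M ⟶ Mstar⟦(1:ℤ)⟧)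
    (htri : Triangle.mk g f δ ∈ distTriang C) :
    -- conclusions:
    Indec Mstar ∧
    ¬ AddMem Tbar Mstar ∧
    (∀ X, MemIso (insert Mstar Tbar) X → ∀ Y, MemIso (insert Mstar Tbar) Y →
      ∀ φ : X ⟶ Y⟦(1:ℤ)⟧, φ = 0) ∧
    ¬ Nonempty (Mstar ≅ M) ∧
    TiltingSet (shiftFunctor C (1:ℤ)) (insert Mstar Tbar) := by
  have symm : ∀ {X Y : C}, ExtZ X Y → ExtZ Y X := by
    intro X Y h φ
    apply (extSym Y X).injective
    rw [map_zero]
    exact h _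
  have hMl := hKS M hM
  have hTl : ∀ X ∈ Tbar, IsLocalRing (End X) := fun X hX => hKS X (hTbar.1 X hX)
  have eTT : ∀ X ∈ Tbar, ∀ Y ∈ Tbar, ExtZ X Y := hTbar.2.2
  have eIns : ∀ X ∈ insert M Tbar, ∀ Y ∈ insert M Tbar, ExtZ X Y := hMcompl.1.2.2
  have eMM : ExtZ M M := eIns M (Set.mem_insert _ _) M (Set.mem_insert _ _)
  have eTM : ∀ X ∈ Tbar, ExtZ X M := fun X hX =>
    eIns X (Set.mem_insert_of_mem _ hX) M (Set.mem_insert _ _)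
  have eMT : ∀ X ∈ Tbar, ExtZ M X := fun X hX => symm (eTM X hX)
  have eMB : ExtZ M B := ExtZ.add_right hBadd eMT
  have fδ : f ≫ δ = 0 := comp_distTriang_mor_zero₂₃ _ htri
  -- no split epi
  have noret : ∀ s : M ⟶ B, ¬ IsIso (s ≫ f) := fun s hs =>
    hMnotin (retract_add hTl hM.1 hMl hBadd s f hs)
  have hδ : δ ≠ 0 := by
    intro h0
    obtain ⟨s, hs⟩ := tx3 htri (𝟙 M) (by
      show 𝟙 M ≫ δ = 0
      rw [h0, comp_zero])
    apply noret s
    have : s ≫ f = 𝟙 M := hs.symm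
    rw [this]; infer_instance
  -- Ext(T, M*) = 0
  have eTS : ∀ X ∈ Tbar, ExtZ X Mstar := by
    intro X hX φ
    obtain ⟨h, hh⟩ := tx1 htri φ (ExtZ.add_right hBadd (eTT X hX) _)
    obtain ⟨t, ht⟩ := happrox X (addMem_of_memIso ⟨X, hX, ⟨Iso.refl X⟩⟩) h
    rw [hh, ← ht]
    show (t ≫ f) ≫ δ = 0
    rw [Category.assoc, fδ, comp_zero]
  have eST : ∀ X ∈ Tbar, ExtZ Mstar X := fun X hX => symm (eTS X hX)
  have eSS : ExtZ Mstar Mstar := by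
    intro φ
    obtain ⟨h, hh⟩ := tx1 htri φ (ExtZ.add_right hBadd eST _)
    obtain ⟨h', hh'⟩ := tri_extend htri h (eMM _)
    obtain ⟨t, ht⟩ := happrox B hBadd h'
    rw [hh, hh', ← ht]
    show (g ≫ t ≫ f) ≫ δ = 0
    rw [Category.assoc, Category.assoc, fδ, comp_zero, comp_zero]
  have nAdd : ¬ AddMem Tbar Mstar := fun h => hδ (ExtZ.add_right h eMT δ)
  have nMS : ¬ Nonempty (Mstar ≅ M) := fun ⟨e⟩ => hδ (eMM.iso_right e δ)
  have nzS : ¬ IsZero Mstar := fun h => nAdd (addMem_of_isZero h)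
  -- endomorphisms of M*
  have isoE : ∀ (e : Mstar ⟶ Mstar) (m : M ⟶ M), δ ≫ e⟦(1:ℤ)⟧' = m ≫ δ → IsIso m → IsIso e := by
    intro e m hem hm
    obtain ⟨b, hb1, hb2⟩ := tm2 htri htri e m hem
    have hb1' : g ≫ b = e ≫ g := hb1
    have hb2' : f ≫ m = b ≫ f := hb2
    obtain ⟨t, ht⟩ := happrox B hBadd (f ≫ inv m)
    have i1 : IsIso (b ≫ t) := by
      apply hmin
      rw [Category.assoc, ht, ← Category.assoc, ← hb2', Category.assoc, IsIso.hom_inv_id,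
        Category.comp_id]
    have i2 : IsIso (t ≫ b) := by
      apply hmin
      rw [Category.assoc, ← hb2', ← Category.assoc, ht, Category.assoc, IsIso.inv_hom_id,
        Category.comp_id]
    have hb : IsIso b := by
      have l : b ≫ (t ≫ inv (b ≫ t)) = 𝟙 _ := by
        rw [← Category.assoc, IsIso.hom_inv_id]
      have r : (inv (t ≫ b) ≫ t) ≫ b = 𝟙 _ := by
        rw [Category.assoc, IsIso.inv_hom_id]
      refine ⟨_, l, ?_⟩
      have : t ≫ inv (b ≫ t) = inv (t ≫ b) ≫ t := by
        rw [← Category.id_comp (t ≫ inv (b ≫ t)), ← r, Category.assoc, l, Category.comp_id]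
      rw [this, r]
    exact mkHom_iso₁ htri htri e b m hb1' hb2' hem hb hm
  have locS : ∀ e : Mstar ⟶ Mstar, IsIso e ∨ IsIso (𝟙 Mstar - e) := by
    intro e
    obtain ⟨m, hm⟩ := tx1 htri (δ ≫ e⟦(1:ℤ)⟧') (eMB _)
    have hm' : δ ≫ e⟦(1:ℤ)⟧' = m ≫ δ := hm
    rcases loc_add hMl (a := m) (b := 𝟙 M - m) (by rw [add_sub_cancel]; infer_instance) with h | h
    · exact Or.inl (isoE e m hm' h)
    · refine Or.inr (isoE _ _ ?_ h)
      rw [Functor.map_sub, CategoryTheory.Functor.map_id, Preadditive.comp_sub, hm',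
        Preadditive.sub_comp, Category.comp_id, Category.id_comp]
  have indS : Indec Mstar := by
    refine ⟨nzS, ?_⟩
    rintro A A' ⟨e⟩
    rcases locS (e.hom ≫ biprod.fst ≫ biprod.inl ≫ e.inv) with h | h
    · right
      rw [IsZero.iff_id_eq_zero]
      have h0 : (biprod.inr ≫ e.inv : A' ⟶ Mstar) = 0 := by
        rw [← cancel_mono (e.hom ≫ biprod.fst ≫ biprod.inl ≫ e.inv)]
        simp
      have : 𝟙 A' = (biprod.inr ≫ e.inv) ≫ e.hom ≫ biprod.snd := by simp
      rw [this, h0, zero_comp]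
    · left
      rw [IsZero.iff_id_eq_zero]
      have h0 : (biprod.inl ≫ e.inv : A ⟶ Mstar) = 0 := by
        rw [← cancel_mono (𝟙 Mstar - e.hom ≫ biprod.fst ≫ biprod.inl ≫ e.inv)]
        simp
      have : 𝟙 A = (biprod.inl ≫ e.inv) ≫ e.hom ≫ biprod.fst := by simp
      rw [this, h0, zero_comp]
  have eAll : ∀ X ∈ insert Mstar Tbar, ∀ Y ∈ insert Mstar Tbar, ExtZ X Y := by
    rintro X (rfl | hX) Y (rfl | hY)
    · exact eSS
    · exact eST Y hY
    · exact eTS X hX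
    · exact eTT X hX Y hY
  have nSmem : ¬ MemIso Tbar Mstar := fun h => nAdd (addMem_of_memIso h)
  have hExc : ExcSet (shiftFunctor C (1:ℤ)) (insert Mstar Tbar) := by
    refine ⟨?_, ?_, eAll⟩
    · rintro X (rfl | hX)
      · exact indS
      · exact hTbar.1 X hX
    · rintro X (rfl | hX) Y (rfl | hY) ⟨e⟩
      · rfl
      · exact absurd ⟨Y, hY, ⟨e⟩⟩ nSmem
      · exact absurd ⟨X, hX, ⟨e.symm⟩⟩ nSmem
      · exact hTbar.2.1 X hX Y hY ⟨e⟩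
  -- maximality of T ∪ {M}
  have hmem : ∀ Z : C, Indec Z → ExtZ Z Z → (∀ Y ∈ insert M Tbar, ExtZ Z Y ∧ ExtZ Y Z) →
      MemIso (insert M Tbar) Z := by
    intro Z hZ hZZ hZY
    by_contra hn
    have : ExcSet (shiftFunctor C (1:ℤ)) (insert Z (insert M Tbar)) := by
      refine ⟨?_, ?_, ?_⟩
      · rintro X (rfl | hX)
        · exact hZ
        · exact hMcompl.1.1 X hX
      · rintro X (rfl | hX) Y (rfl | hY) ⟨e⟩
        · rfl
        · exact absurd ⟨Y, hY, ⟨e⟩⟩ hn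
        · exact absurd ⟨X, hX, ⟨e.symm⟩⟩ hn
        · exact hMcompl.1.2.1 X hX Y hY ⟨e⟩
      · rintro X (rfl | hX) Y (rfl | hY)
        · exact hZZ
        · exact (hZY Y hY).1
        · exact (hZY X hX).2
        · exact eIns X hX Y hY
    have h2 := hMcompl.2 _ this (Set.subset_insert _ _)
    have h3 : Z ∈ insert M Tbar := by
      rw [← h2]; exact Set.mem_insert _ _
    exact hn ⟨Z, h3, ⟨Iso.refl Z⟩⟩
  -- key: maximality of T ∪ {M*}
  have hkey : ∀ X : C, Indec X → ExtZ X X → (∀ Y ∈ Tbar, ExtZ X Y) → ExtZ X Mstar →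
      ¬ MemIso Tbar X → Nonempty (X ≅ Mstar) := by
    intro X hX eXX eXT eXS hXn
    have eTX : ∀ Y ∈ Tbar, ExtZ Y X := fun Y hY => symm (eXT Y hY)
    obtain ⟨n, η, hgen, hminη⟩ := min_gen (k := k) (M := M) (N := X⟦(1:ℤ)⟧)
    by_cases hn : n = 0
    · subst hn
      exfalso
      have eMX : ExtZ M X := by
        intro φ
        obtain ⟨c, hc⟩ := hgen φ
        rw [hc]; simp
      obtain ⟨Y, hY, ⟨e⟩⟩ := hmem X hX eXX (by
        rintro Y (rfl | hY)
        · exact ⟨symm eMX, eMX⟩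
        · exact ⟨eXT Y hY, eTX Y hY⟩)
      rcases hY with rfl | hY
      · exact hδ (eXS.iso_left e.symm δ)
      · exact hXn ⟨Y, hY, ⟨e⟩⟩
    let Mn : C := biproduct (fun _ : Fin n => M)
    let H : Mn ⟶ X⟦(1:ℤ)⟧ := biproduct.desc η
    obtain ⟨E, a, q, hE⟩ := distinguished_cocone_triangle₂ H
    have qH : q ≫ H = 0 := comp_distTriang_mor_zero₂₃ _ hE
    have aq : a ≫ q = 0 := comp_distTriang_mor_zero₁₂ _ hE
    have Ha : H ≫ a⟦(1:ℤ)⟧' = 0 := comp_distTriang_mor_zero₃₁ _ hE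
    have ext_mid : ∀ Y : C, ExtZ Y X → ExtZ Y Mn → ExtZ Y E := by
      intro Y h1 h2 φ
      obtain ⟨ψ, hψ⟩ := tri_exact_shift₂ hE φ (h2 _)
      rw [hψ, h1 ψ, zero_comp]
    have eTE : ∀ Y ∈ Tbar, ExtZ Y E := fun Y hY =>
      ext_mid Y (eTX Y hY) (ExtZ.biprod_right fun _ => eTM Y hY)
    have eME : ExtZ M E := by
      intro φ
      obtain ⟨ψ, hψ⟩ := tri_exact_shift₂ hE φ ((ExtZ.biprod_right fun _ => eMM : ExtZ M Mn) _)
      obtain ⟨c, hc⟩ := hgen ψ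
      have : ψ = biproduct.lift c ≫ H := by
        rw [hc, biproduct.lift_desc]
      rw [hψ, this, Category.assoc, Ha, comp_zero]
    have eMnE : ExtZ Mn E := ExtZ.biprod_left fun _ => eME
    have eEM : ExtZ E M := symm eME
    have eEE : ExtZ E E := by
      intro φ
      obtain ⟨ψ, hψ⟩ := tri_exact_shift₂ hE φ ((ExtZ.biprod_right fun _ => eEM : ExtZ E Mn) _)
      obtain ⟨χ, hχ⟩ := ty2 hE ψ (eXX _)
      have hχ' : ψ = q ≫ χ := hχ
      rw [hψ, hχ', Category.assoc, eMnE (χ ≫ _), comp_zero]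
    have hnoM : ∀ (s : M ⟶ E) (r : E ⟶ M), s ≫ r ≠ 𝟙 M := by
      intro s r hsr
      obtain ⟨t, ht⟩ := tx3 htri (a ≫ r) (eXS _)
      have ht' : a ≫ r = t ≫ f := ht
      obtain ⟨t', ht2⟩ := tri_extend hE t
        ((ExtZ.biprod_left fun _ => eMB : ExtZ Mn B) _)
      obtain ⟨w, hw⟩ := ty2 hE (r - t' ≫ f) (by
        show a ≫ (r - t' ≫ f) = 0
        rw [Preadditive.comp_sub, ht', ← Category.assoc, ← ht2, sub_self])
      have hw' : r - t' ≫ f = q ≫ w := hw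
      have h1 : (s ≫ t') ≫ f + (s ≫ q) ≫ w = 𝟙 M := by
        rw [Category.assoc, Category.assoc, ← hw', ← Preadditive.comp_add, add_sub_cancel, hsr]
      rcases loc_add hMl (a := (s ≫ t') ≫ f) (b := (s ≫ q) ≫ w)
        (by rw [h1]; infer_instance) with h | h
      · exact noret _ h
      · have hsum : (s ≫ q) ≫ w = ∑ i, (s ≫ q ≫ biproduct.π (fun _ : Fin n => M) i) ≫
            (biproduct.ι (fun _ : Fin n => M) i ≫ w) := by
          have : (s ≫ q) ≫ w = s ≫ q ≫ 𝟙 Mn ≫ w := by simp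
          rw [this, ← biproduct.total]
          simp only [Preadditive.sum_comp, Preadditive.comp_sum, Category.assoc]
        rw [hsum] at h
        obtain ⟨i, hi⟩ := loc_sum hM.1 hMl _ _ h
        set u := s ≫ q ≫ biproduct.π (fun _ : Fin n => M) i with hu
        set v := biproduct.ι (fun _ : Fin n => M) i ≫ w
        obtain ⟨e⟩ := retract_iso hMl hM.1 u (v ≫ inv (u ≫ v))
          (by rw [← Category.assoc, IsIso.hom_inv_id])
        have huv : IsIso (v ≫ inv (u ≫ v) ≫ u) := by
          have hp : IsIso ((v ≫ inv (u ≫ v) ≫ u) + (𝟙 M - v ≫ inv (u ≫ v) ≫ u)) := by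
            rw [add_sub_cancel]; infer_instance
          rcases loc_add hMl hp with h5 | h5
          · exact h5
          · exfalso
            have h6 : u = 0 := by
              rw [← cancel_mono (𝟙 M - v ≫ inv (u ≫ v) ≫ u), zero_comp, Preadditive.comp_sub,
                Category.comp_id, ← Category.assoc u v, IsIso.hom_inv_id_assoc, sub_self]
            apply hM.1
            rw [IsZero.iff_id_eq_zero, ← IsIso.hom_inv_id (u ≫ v)]
            simp only [h6, zero_comp]
        have hid : v ≫ inv (u ≫ v) ≫ u = 𝟙 M := by
          rw [← cancel_mono (v ≫ inv (u ≫ v) ≫ u)]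
          simp only [Category.assoc, Category.id_comp]
          rw [← Category.assoc u v, IsIso.hom_inv_id_assoc]
        have huiso : IsIso u :=
          ⟨v ≫ inv (u ≫ v), by rw [← Category.assoc, IsIso.hom_inv_id], by
            rw [Category.assoc, hid]⟩
        refine hminη (fun j => s ≫ q ≫ biproduct.π (fun _ : Fin n => M) j) ?_ i huiso
        have h9 : s ≫ q ≫ H = 0 := by rw [qH, comp_zero]
        have h10 : s ≫ q ≫ H = s ≫ q ≫ 𝟙 Mn ≫ H := by simp
        rw [h10, ← biproduct.total] at h9
        simpa only [Preadditive.sum_comp, Preadditive.comp_sum, Category.assoc, H,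
          biproduct.ι_desc] using h9
    have hfac := factor_of_compat k f happrox hmem E eEE (by
      rintro Y (rfl | hY)
      · exact ⟨eEM, eME⟩
      · exact ⟨symm (eTE Y hY), eTE Y hY⟩) hnoM
    let j : Fin n := ⟨0, Nat.pos_of_ne_zero hn⟩
    let u : M ⟶ Mn := biproduct.ι (fun _ : Fin n => M) j
    let v : Mn ⟶ M := biproduct.π (fun _ : Fin n => M) j
    have huv : u ≫ v = 𝟙 M := biproduct.ι_π_self _ _
    obtain ⟨b1, hb1⟩ := tx3 hE (f ≫ u) ((ExtZ.add_left hBadd eTX) _)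
    have hb1' : f ≫ u = b1 ≫ q := hb1
    obtain ⟨b2, hb2⟩ := hfac (q ≫ v)
    obtain ⟨a1, h11, h12⟩ := tm1 htri hE b1 u hb1'
    obtain ⟨a2, h21, h22⟩ := tm1 hE htri b2 v hb2.symm
    have h11' : g ≫ b1 = a1 ≫ a := h11
    have h12' : δ ≫ a1⟦(1:ℤ)⟧' = u ≫ H := h12
    have h21' : a ≫ b2 = a2 ≫ g := h21
    have h22' : H ≫ a2⟦(1:ℤ)⟧' = v ≫ δ := h22
    have hiso : IsIso (a1 ≫ a2) := by
      refine isoE _ (𝟙 M) ?_ inferInstance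
      rw [Functor.map_comp, ← Category.assoc, h12', Category.assoc, h22', ← Category.assoc, huv]
    exact retract_iso (hKS X hX) nzS a1 (a2 ≫ inv (a1 ≫ a2))
      (by rw [← Category.assoc, IsIso.hom_inv_id])
  refine ⟨indS, nAdd, ?_, nMS, hExc, ?_⟩
  · rintro X ⟨X', hX', ⟨e⟩⟩ Y ⟨Y', hY', ⟨e'⟩⟩
    exact ((eAll X' hX' Y' hY').iso_left e).iso_right e'
  · intro T' hT' hsub
    apply Set.Subset.antisymm _ hsub
    intro X hX
    by_cases hXm : MemIso Tbar X
    · obtain ⟨Y, hY, e⟩ := hXm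
      rw [hT'.2.1 X hX Y (hsub (Set.mem_insert_of_mem _ hY)) e]
      exact Set.mem_insert_of_mem _ hY
    · have hS := hsub (Set.mem_insert Mstar Tbar)
      have := hkey X (hT'.1 X hX) (hT'.2.2 X hX X hX)
        (fun Y hY => hT'.2.2 X hX Y (hsub (Set.mem_insert_of_mem _ hY)))
        (hT'.2.2 X hX Mstar hS) hXm
      rw [hT'.2.1 X hX Mstar hS this]
      exact Set.mem_insert _ _
end

section
/- Let Q be a quiver whose underlying graph is a simply-laced Dynkin diagram and let U, V be indecomposable kQ-modules with Hom_{kQ}(U,V) ≠ 0 and Ext¹_{kQ}(V,U) = 0. Then dim_k Hom_{kQ}(U,V) = 1. -/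
open CategoryTheory CategoryTheory.Limits

attribute [local instance] CategoryTheory.Abelian.hasFiniteBiproducts

/-- `Ext¹(X, Z) = 0`, expressed by the splitting of all short exact sequences
`0 → Z → E → X → 0`. -/
def Ext1Zero {A : Type*} [Category A] [Preadditive A] (X Z : A) : Prop :=
  ∀ (E : A) (ι : Z ⟶ E) (p : E ⟶ X) (w : ι ≫ p = 0),
    (ShortComplex.mk ι p w).ShortExact → ∃ r : E ⟶ Z, ι ≫ r = 𝟙 Z


/-- Linear algebra: factor through a map with smaller kernel. -/
theorem qr_factor {k A B C : Type*} [Field k] [AddCommGroup A] [Module k A] [AddCommGroup B]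
    [Module k B] [AddCommGroup C] [Module k C] (f : A →ₗ[k] B) (g : A →ₗ[k] C)
    (h : ∀ x, f x = 0 → g x = 0) : ∃ φ : B →ₗ[k] C, ∀ x, φ (f x) = g x := by
  obtain ⟨r, hr⟩ := f.rangeRestrict.exists_rightInverse_of_surjective f.range_rangeRestrict
  obtain ⟨φ, hφ⟩ := LinearMap.exists_extend (g ∘ₗ r)
  refine ⟨φ, fun x => ?_⟩
  have h1 : φ (f x) = g (r (f.rangeRestrict x)) := by
    have := LinearMap.congr_fun hφ (f.rangeRestrict x)
    simpa using this
  rw [h1, ← sub_eq_zero, ← map_sub]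
  apply h
  rw [map_sub, sub_eq_zero]
  have := LinearMap.congr_fun hr (f.rangeRestrict x)
  simpa using congrArg Subtype.val this

/-- Fitting for finite-dimensional algebras with only trivial idempotents. -/
theorem qr_fitting {k A : Type*} [Field k] [Ring A] [Algebra k A] [FiniteDimensional k A]
    (h : ∀ e : A, e * e = e → e = 0 ∨ e = 1) (t : A) : IsUnit t ∨ IsNilpotent t := by
  have hint : IsIntegral k t := Algebra.IsIntegral.isIntegral t
  obtain ⟨q, hq, hnd⟩ := (minpoly k t).exists_eq_pow_rootMultiplicity_mul_and_not_dvd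
    (minpoly.ne_zero hint) 0
  simp only [map_zero, sub_zero] at hq hnd
  set n := (minpoly k t).rootMultiplicity 0
  have hcop : IsCoprime ((Polynomial.X : Polynomial k) ^ (n+1)) q :=
    IsCoprime.pow_left ((Polynomial.irreducible_X.coprime_iff_not_dvd).2 hnd)
  obtain ⟨a, b, hab⟩ := hcop
  have h0 : Polynomial.aeval t (Polynomial.X ^ n * q) = 0 := by rw [← hq]; exact minpoly.aeval k t
  have h0' : Polynomial.aeval t (Polynomial.X ^ (n+1) * q) = 0 := by
    rw [show (Polynomial.X ^ (n+1) * q : Polynomial k) = Polynomial.X * (Polynomial.X ^ n * q) by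
      ring, map_mul, h0, mul_zero]
  set e := Polynomial.aeval t (a * Polynomial.X ^ (n+1)) with he
  have hidem : e * e = e := by
    have : a * Polynomial.X ^ (n+1) * (a * Polynomial.X ^ (n+1)) =
        a * Polynomial.X ^ (n+1) - a * b * (Polynomial.X ^ (n+1) * q) := by
      linear_combination (a * Polynomial.X ^ (n+1)) * hab
    rw [he, ← map_mul, this, map_sub, map_mul _ (a * b), h0', mul_zero, sub_zero]
  rcases h e hidem with h1 | h1
  · right
    refine ⟨n + 1, ?_⟩
    have : (Polynomial.X ^ (n+1) : Polynomial k) =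
        Polynomial.X ^ (n+1) * (a * Polynomial.X ^ (n+1)) + b * (Polynomial.X ^ (n+1) * q) := by
      linear_combination (-(Polynomial.X ^ (n+1))) * hab
    have h2 := congrArg (Polynomial.aeval t) this
    rw [map_add, map_mul, ← he, h1, map_mul _ b, h0', mul_zero, mul_zero, add_zero] at h2
    simpa using h2
  · left
    have h3 : Polynomial.aeval t (a * Polynomial.X ^ n) * t = 1 := by
      rw [← h1, he]
      conv_lhs => rw [← Polynomial.aeval_X (R := k) t]
      simp [pow_succ, mul_assoc]
    have h4 : t * Polynomial.aeval t (a * Polynomial.X ^ n) = 1 := by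
      rw [← h3]
      conv_lhs => enter [1]; rw [← Polynomial.aeval_X (R := k) t]
      conv_rhs => enter [2]; rw [← Polynomial.aeval_X (R := k) t]
      rw [← map_mul, ← map_mul, mul_comm]
    exact ⟨⟨t, _, h4, h3⟩, rfl⟩

structure QRep (k : Type) [Field k] (Q : Type) [Quiver.{1} Q] where
  V : Q → Type
  [acg : ∀ a, AddCommGroup (V a)]
  [mod : ∀ a, Module k (V a)]
  [fd : ∀ a, FiniteDimensional k (V a)]
  map : ∀ {a b : Q}, (a ⟶ b) → (V a →ₗ[k] V b)

namespace QRep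

set_option linter.unusedSectionVars false

attribute [instance] QRep.acg QRep.mod QRep.fd

variable {k : Type} [Field k] {Q : Type} [Quiver.{1} Q]

def IsHom (X Y : QRep k Q) (f : ∀ a, X.V a →ₗ[k] Y.V a) : Prop :=
  ∀ (a b : Q) (m : a ⟶ b) (x : X.V a), f b (X.map m x) = Y.map m (f a x)

/-- the differential -/
def d (X Y : QRep k Q) : (∀ a, X.V a →ₗ[k] Y.V a) →ₗ[k]
    (∀ m : (Σ a : Q, Σ b : Q, (a ⟶ b)), X.V m.1 →ₗ[k] Y.V m.2.1) where
  toFun f := fun m => f m.2.1 ∘ₗ X.map m.2.2 - Y.map m.2.2 ∘ₗ f m.1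
  map_add' f g := by
    funext m; ext x; simp; abel
  map_smul' c f := by
    funext m; ext x; simp [smul_sub]

theorem mem_ker_d {X Y : QRep k Q} {f : ∀ a, X.V a →ₗ[k] Y.V a} :
    f ∈ LinearMap.ker (d X Y) ↔ IsHom X Y f := by
  rw [LinearMap.mem_ker]
  constructor
  · intro h a b m x
    have := LinearMap.congr_fun (congrFun h ⟨a, b, m⟩) x
    simpa [d, sub_eq_zero] using this
  · intro h
    funext m
    ext x
    simpa [d, sub_eq_zero] using h _ _ m.2.2 x

/-- vanishing of Ext -/
def ExtVan (X Y : QRep k Q) : Prop :=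
  ∀ φ : (∀ (a b : Q), (a ⟶ b) → (X.V a →ₗ[k] Y.V b)),
    ∃ σ : ∀ a, X.V a →ₗ[k] Y.V a, ∀ (a b : Q) (m : a ⟶ b) (x : X.V a),
      φ a b m x = σ b (X.map m x) - Y.map m (σ a x)

theorem extVan_iff (X Y : QRep k Q) : ExtVan X Y ↔ Function.Surjective (d X Y) := by
  constructor
  · intro h φ
    obtain ⟨σ, hσ⟩ := h (fun a b m => φ ⟨a, b, m⟩)
    refine ⟨σ, ?_⟩
    funext m
    ext x
    simpa [d] using (hσ _ _ m.2.2 x).symm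
  · intro h φ
    obtain ⟨σ, hσ⟩ := h (fun m => φ m.1 m.2.1 m.2.2)
    refine ⟨σ, fun a b m x => ?_⟩
    have := LinearMap.congr_fun (congrFun hσ ⟨a, b, m⟩) x
    simpa [d] using this.symm

noncomputable def dim (X : QRep k Q) (a : Q) : ℕ := Module.finrank k (X.V a)

section euler
variable [Fintype Q] [∀ a b : Q, Fintype (a ⟶ b)]

/-- Euler form -/
def eu (x y : Q → ℚ) : ℚ := (∑ a : Q, x a * y a) -
        ∑ a : Q, ∑ b : Q, (Fintype.card (a ⟶ b) : ℚ) * (x a * y b)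

noncomputable def dv (X : QRep k Q) (a : Q) : ℚ := (dim X a : ℚ)

noncomputable def h (X Y : QRep k Q) : ℕ := Module.finrank k (LinearMap.ker (d X Y))

theorem finrank_dom (X Y : QRep k Q) :
    (Module.finrank k (∀ a, X.V a →ₗ[k] Y.V a) : ℚ) = ∑ a, dv X a * dv Y a := by
  rw [Module.finrank_pi_fintype]
  simp [Module.finrank_linearMap, dv, dim]

theorem finrank_cod (X Y : QRep k Q) :
    (Module.finrank k (∀ m : (Σ a : Q, Σ b : Q, (a ⟶ b)), X.V m.1 →ₗ[k] Y.V m.2.1) : ℚ) =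
      ∑ a : Q, ∑ b : Q, (Fintype.card (a ⟶ b) : ℚ) * (dv X a * dv Y b) := by
  rw [Module.finrank_pi_fintype]
  simp only [Module.finrank_linearMap, Fintype.sum_sigma, Nat.cast_sum, Nat.cast_mul, dv, dim]
  refine Finset.sum_congr rfl fun a _ => Finset.sum_congr rfl fun b _ => ?_
  have e := Finset.sum_const (s := (Finset.univ : Finset (a ⟶ b)))
    ((Module.finrank k (X.V a) : ℚ) * Module.finrank k (Y.V b))
  rw [nsmul_eq_mul, Finset.card_univ] at e
  exact e

theorem euler_eq (X Y : QRep k Q) : (h X Y : ℚ) - eu (dv X) (dv Y) =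
    (Module.finrank k (∀ m : (Σ a : Q, Σ b : Q, (a ⟶ b)), X.V m.1 →ₗ[k] Y.V m.2.1) : ℚ)
      - Module.finrank k (LinearMap.range (d X Y)) := by
  have := LinearMap.finrank_range_add_finrank_ker (d X Y)
  have h2 : (Module.finrank k (LinearMap.range (d X Y)) : ℚ) + h X Y
     = ∑ a, dv X a * dv Y a := by
    rw [← finrank_dom, ← this]; push_cast; rfl
  rw [finrank_cod, eu]
  linarith

theorem euler_of_ext (X Y : QRep k Q) (hx : ExtVan X Y) : (h X Y : ℚ) = eu (dv X) (dv Y) := by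
  have := euler_eq X Y
  rw [extVan_iff, ← LinearMap.range_eq_top] at hx
  rw [hx, finrank_top] at this
  linarith

theorem ext_of_euler (X Y : QRep k Q) (hx : (h X Y : ℚ) ≤ eu (dv X) (dv Y)) : ExtVan X Y := by
  have := euler_eq X Y
  rw [extVan_iff, ← LinearMap.range_eq_top]
  apply Submodule.eq_top_of_finrank_eq
  apply le_antisymm (Submodule.finrank_le _)
  have : (Module.finrank k (∀ m : (Σ a : Q, Σ b : Q, (a ⟶ b)), X.V m.1 →ₗ[k] Y.V m.2.1) : ℚ)
      ≤ Module.finrank k (LinearMap.range (d X Y)) := by linarith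
  exact_mod_cast this

theorem eu_int (X Y : QRep k Q) : ∃ z : ℤ, eu (dv X) (dv Y) = z := by
  refine ⟨(∑ a : Q, (dim X a : ℤ) * dim Y a) -
        ∑ a : Q, ∑ b : Q, (Fintype.card (a ⟶ b) : ℤ) * (dim X a * dim Y b), ?_⟩
  simp [eu, dv]

theorem eu_sub (x y : Q → ℚ) : eu (x - y) (x - y) = eu x x - eu x y - eu y x + eu y y := by
  simp only [eu, Pi.sub_apply, sub_mul, mul_sub, Finset.sum_sub_distrib]
  ring

end euler

/-- Endomorphism algebra -/
def End (X : QRep k Q) : Subalgebra k (∀ a, Module.End k (X.V a)) where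
  carrier := {f | IsHom X X f}
  mul_mem' := by
    intro f g hf hg a b m x
    simp only [Pi.mul_apply, Module.End.mul_apply]
    rw [hg, hf]
  add_mem' := by
    intro f g hf hg a b m x
    simp [hf _ _ m x, hg _ _ m x]
  algebraMap_mem' := by
    intro r a b m x
    simp [Pi.algebraMap_apply, Module.algebraMap_end_apply]

theorem mem_End {X : QRep k Q} {f : ∀ a, Module.End k (X.V a)} : f ∈ End X ↔ IsHom X X f := Iff.rfl

def Indec (X : QRep k Q) : Prop := (∃ a, Nontrivial (X.V a)) ∧
  ∀ e : (∀ a, X.V a →ₗ[k] X.V a), IsHom X X e → (∀ a x, e a (e a x) = e a x) →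
    (∀ a x, e a x = 0) ∨ (∀ a x, e a x = x)

theorem indec_end {X : QRep k Q} (hX : Indec X) (e : End X) (he : e * e = e) : e = 0 ∨ e = 1 := by
  rcases hX.2 e.1 e.2 (fun a x => by
    have := LinearMap.congr_fun (congrFun (congrArg Subtype.val he) a) x
    simpa using this) with h | h
  · left; ext a x; simpa using h a x
  · right; ext a x; simpa using h a x

theorem isHom_comp {X Y Z : QRep k Q} {f : ∀ a, X.V a →ₗ[k] Y.V a} {g : ∀ a, Y.V a →ₗ[k] Z.V a}
    (hf : IsHom X Y f) (hg : IsHom Y Z g) : IsHom X Z (fun a => g a ∘ₗ f a) := by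
  intro a b m x
  simp [hf _ _ m x, hg _ _ m _]

theorem isHom_sub {X Y : QRep k Q} {f g : ∀ a, X.V a →ₗ[k] Y.V a}
    (hf : IsHom X Y f) (hg : IsHom X Y g) : IsHom X Y (fun a => f a - g a) := by
  intro a b m x
  simp [hf _ _ m x, hg _ _ m _]

/-- the subrepresentation -/
def sub (X : QRep k Q) (W : ∀ a, Submodule k (X.V a))
    (hW : ∀ (a b : Q) (m : a ⟶ b), ∀ x ∈ W a, X.map m x ∈ W b) : QRep k Q where
  V a := W a
  map {a b} m := (X.map m).restrict (hW a b m)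

theorem isHom_subtype (X : QRep k Q) (W : ∀ a, Submodule k (X.V a))
    (hW : ∀ (a b : Q) (m : a ⟶ b), ∀ x ∈ W a, X.map m x ∈ W b) :
    IsHom (sub X W hW) X (fun a => (W a).subtype) := by
  intro a b m x; rfl


theorem end_unit_or_nilp [Fintype Q] {X : QRep k Q} (hX : Indec X) (t : End X) :
    IsUnit t ∨ IsNilpotent t := qr_fitting (k := k) (indec_end hX) t

theorem unit_bij {X : QRep k Q} {t : End X} (ht : IsUnit t) (a : Q) :
    Function.Bijective (t.1 a) := by
  obtain ⟨u, rfl⟩ := ht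
  have h1 : ∀ x, (u⁻¹ : (End X)ˣ).1.1 a (u.1.1 a x) = x := fun x => by
    have := congrArg Subtype.val u.inv_mul
    exact LinearMap.congr_fun (congrFun this a) x
  have h2 : ∀ x, u.1.1 a ((u⁻¹ : (End X)ˣ).1.1 a x) = x := fun x => by
    have := congrArg Subtype.val u.mul_inv
    exact LinearMap.congr_fun (congrFun this a) x
  exact ⟨Function.LeftInverse.injective h1, Function.RightInverse.surjective h2⟩

/-- Happel--Ringel -/
theorem mono_or_epi [Fintype Q] {U V : QRep k Q} (hU : Indec U) (hV : Indec V) (hE : ExtVan V U)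
    (f : ∀ a, U.V a →ₗ[k] V.V a) (hf : IsHom U V f) (hne : ∃ a x, f a x ≠ 0) :
    (∀ a, Function.Injective (f a)) ∨ (∀ a, Function.Surjective (f a)) := by
  -- s a : V a → U a with f s f = f
  have hs : ∀ a, ∃ s : V.V a →ₗ[k] U.V a, ∀ x, f a (s (f a x)) = f a x := by
    intro a
    obtain ⟨r, hr⟩ := (f a).rangeRestrict.exists_rightInverse_of_surjective
      (f a).range_rangeRestrict
    obtain ⟨φ, hφ⟩ := LinearMap.exists_extend r
    refine ⟨φ, fun x => ?_⟩
    have h1 : φ (f a x) = r ((f a).rangeRestrict x) := by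
      have := LinearMap.congr_fun hφ ((f a).rangeRestrict x)
      simpa using this
    rw [h1]
    have := LinearMap.congr_fun hr ((f a).rangeRestrict x)
    simpa using congrArg Subtype.val this
  choose s hs using hs
  -- p = f s, cocycle
  obtain ⟨σ, hσ⟩ := hE (fun a b m => s b ∘ₗ (f b ∘ₗ s b ∘ₗ V.map m - V.map m ∘ₗ f a ∘ₗ s a))
  have hσ' : ∀ (a b : Q) (m : a ⟶ b) (x : V.V a),
      s b (f b (s b (V.map m x)) - V.map m (f a (s a x))) =
        σ b (V.map m x) - U.map m (σ a x) := by
    intro a b m x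
    simpa using hσ a b m x
  have hfσ : ∀ (a b : Q) (m : a ⟶ b) (x : V.V a),
      f b (s b (V.map m x)) - V.map m (f a (s a x)) =
        f b (σ b (V.map m x)) - V.map m (f a (σ a x)) := by
    intro a b m x
    have := congrArg (f b) (hσ' a b m x)
    rw [map_sub (f b), hf] at this
    rw [← this, ← hf, ← map_sub, hs]
  have hα : (fun a => σ a ∘ₗ f a : ∀ a, Module.End k (U.V a)) ∈ End U := by
    intro a b m x
    have := hσ' a b m (f a x)
    rw [hs, ← hf, hs, sub_self, map_zero] at this
    simpa [sub_eq_zero] using this.symm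
  have hρ : (fun a => f a ∘ₗ s a - f a ∘ₗ σ a : ∀ a, Module.End k (V.V a)) ∈ End V := by
    intro a b m x
    have := hfσ a b m x
    simp only [LinearMap.sub_apply, LinearMap.comp_apply, map_sub]
    rw [sub_eq_sub_iff_add_eq_add] at this ⊢
    rw [add_comm] at this
    rw [add_comm, this, add_comm]
  set α : End U := ⟨_, hα⟩ with hαd
  set ρ : End V := ⟨_, hρ⟩ with hρd
  rcases end_unit_or_nilp hU α with h1 | h1
  · left
    intro a
    have := (unit_bij h1 a).1
    exact Function.Injective.of_comp (f := σ a) (by simpa [hαd] using this)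
  · right
    have hu := h1.isUnit_one_sub
    rcases end_unit_or_nilp hV ρ with h2 | ⟨n, h2⟩
    · intro a y
      obtain ⟨x, hx⟩ := (unit_bij h2 a).2 y
      refine ⟨s a x - σ a x, ?_⟩
      rw [← hx]
      simp [hρd]
    · exfalso
      have hpow : ∀ n a x, (ρ ^ n).1 a (f a x) = f a (((1 - α) ^ n).1 a x) := by
        intro n
        induction n with
        | zero => intro a x; simp
        | succ n ih =>
          intro a x
          have e1 : (ρ ^ (n+1)).1 a (f a x) = (ρ ^ n).1 a (ρ.1 a (f a x)) := by
            rw [pow_succ]; simp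
          have e2 : (((1 - α) ^ (n+1))).1 a x = ((1 - α) ^ n).1 a ((1 - α).1 a x) := by
            rw [pow_succ]; rfl
          have e3 : ρ.1 a (f a x) = f a ((1 - α).1 a x) := by
            simp [hρd, hαd, hs]
          rw [e1, e2, e3, ih]
      obtain ⟨a, x, hx⟩ := hne
      obtain ⟨y, hy⟩ := (unit_bij (hu.pow n) a).2 x
      apply hx
      rw [← hy, ← hpow, h2]
      simp

theorem exists_min {α : Type*} (P : α → Prop) (f : α → ℕ) (h : ∃ x, P x) :
    ∃ x, P x ∧ ∀ y, P y → f x ≤ f y := by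
  obtain ⟨x, hx, hm⟩ := (measure f).wf.has_min {x | P x} h
  exact ⟨x, hx, fun y hy => not_lt.1 (hm y hy)⟩

noncomputable def tot [Fintype Q] (X : QRep k Q) : ℕ := ∑ a, dim X a

theorem ringel [Fintype Q] {X : QRep k Q} (hX : Indec X)
    (hex : ∃ θ : ∀ a, X.V a →ₗ[k] X.V a, IsHom X X θ ∧ (∀ a x, θ a (θ a x) = 0) ∧
      ∃ a x, θ a x ≠ 0) : ∃ Y : QRep k Q, Indec Y ∧ tot Y < tot X ∧ ¬ ExtVan Y Y := by
  obtain ⟨θ, ⟨hθ, hθ2, hθ0⟩, hθmin⟩ := exists_min _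
    (fun θ : ∀ a, X.V a →ₗ[k] X.V a => ∑ a, Module.finrank k (LinearMap.range (θ a))) hex
  have hW : ∀ (a b : Q) (m : a ⟶ b), ∀ x ∈ LinearMap.ker (θ a), X.map m x ∈ LinearMap.ker (θ b) := by
    intro a b m x hx
    rw [LinearMap.mem_ker] at hx ⊢
    rw [hθ, hx, map_zero]
  let K : QRep k Q := sub X (fun a => LinearMap.ker (θ a)) hW
  let ι : ∀ a, K.V a →ₗ[k] X.V a := fun a => (LinearMap.ker (θ a)).subtype
  have hι : IsHom K X ι := isHom_subtype _ _ _
  have hθι : ∀ a x, θ a (ι a x) = 0 := fun a x => x.2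
  let θ' : ∀ a, X.V a →ₗ[k] K.V a := fun a =>
    (θ a).codRestrict (LinearMap.ker (θ a)) (fun x => hθ2 a x)
  have hιθ' : ∀ a x, ι a (θ' a x) = θ a x := fun a x => rfl
  have hιinj : ∀ a, Function.Injective (ι a) := fun a => Subtype.val_injective
  have hθ' : IsHom X K θ' := by
    intro a b m x
    apply hιinj
    rw [hι, hιθ', hιθ', hθ]
  obtain ⟨Y, ⟨i, p, hi, hp, hpi, a₀, x₀, hne⟩, hmin⟩ := exists_min
    (fun Y : QRep k Q => ∃ (i : ∀ a, Y.V a →ₗ[k] K.V a) (p : ∀ a, K.V a →ₗ[k] Y.V a),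
      IsHom Y K i ∧ IsHom K Y p ∧ (∀ a y, p a (i a y) = y) ∧ ∃ a x, p a (θ' a x) ≠ 0)
    tot ⟨K, fun a => LinearMap.id, fun a => LinearMap.id, fun a b m x => rfl, fun a b m x => rfl,
      fun a x => rfl, by
        obtain ⟨a, x, h⟩ := hθ0
        refine ⟨a, x, fun h' => h ?_⟩
        rw [← hιθ']
        rw [LinearMap.id_apply] at h'
        rw [h', map_zero]⟩
  have key : ∀ e : ∀ a, Y.V a →ₗ[k] Y.V a, IsHom Y Y e → (∀ a x, e a (e a x) = e a x) →
      (∃ a x, e a (p a (θ' a x)) ≠ 0) → ∀ a x, e a x = x := by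
    intro e he he2 ⟨a₁, x₁, h1⟩
    have hW' : ∀ (a b : Q) (m : a ⟶ b), ∀ x ∈ LinearMap.range (e a),
        Y.map m x ∈ LinearMap.range (e b) := by
      rintro a b m _ ⟨x, rfl⟩
      exact ⟨Y.map m x, he _ _ _ _⟩
    have hle := hmin (sub Y (fun a => LinearMap.range (e a)) hW')
      ⟨fun a => i a ∘ₗ (LinearMap.range (e a)).subtype, fun a => (e a).rangeRestrict ∘ₗ p a,
        isHom_comp (isHom_subtype _ _ _) hi, by
          intro a b m x
          apply Subtype.ext
          change e b (p b (K.map m x)) = Y.map m (e a (p a x))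
          rw [hp, he], by
          rintro a ⟨_, ⟨y, rfl⟩⟩
          apply Subtype.ext
          change e a (p a (i a (e a y))) = e a y
          rw [hpi, he2], a₁, x₁, fun h => h1 (congrArg Subtype.val h)⟩
    have hle2 : ∀ a ∈ Finset.univ, Module.finrank k (LinearMap.range (e a)) ≤
        Module.finrank k (Y.V a) := fun a _ => Submodule.finrank_le _
    have heq := (Finset.sum_eq_sum_iff_of_le hle2).1 (le_antisymm (Finset.sum_le_sum hle2) hle)
    intro a x
    have ht := Submodule.eq_top_of_finrank_eq (heq a (Finset.mem_univ a))
    obtain ⟨y, rfl⟩ := LinearMap.range_eq_top.1 ht x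
    exact he2 a y
  have hYnt : ∃ a, Nontrivial (Y.V a) := ⟨a₀, ⟨_, _, hne⟩⟩
  refine ⟨Y, ⟨hYnt, ?_⟩, ?_, ?_⟩
  · intro e he he2
    by_cases h1 : ∃ a x, e a (p a (θ' a x)) ≠ 0
    · exact Or.inr (key e he he2 h1)
    · left
      push Not at h1
      have := key (fun a => LinearMap.id - e a) (isHom_sub (fun a b m x => rfl) he)
        (by intro a x; simp [he2]) ⟨a₀, x₀, by simpa [h1] using hne⟩
      intro a x
      simpa using this a x
  · have h1 : tot Y ≤ tot K := by
      apply Finset.sum_le_sum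
      intro a _
      exact LinearMap.finrank_le_finrank_of_injective (f := i a)
        (Function.LeftInverse.injective (hpi a))
    refine lt_of_le_of_lt h1 ?_
    obtain ⟨a, x, hax⟩ := hθ0
    apply Finset.sum_lt_sum
    · intro a _
      exact Submodule.finrank_le (LinearMap.ker (θ a))
    · refine ⟨a, Finset.mem_univ a, Submodule.finrank_lt (s := LinearMap.ker (θ a)) ?_⟩
      intro h
      exact hax (LinearMap.mem_ker.1 (h ▸ Submodule.mem_top))
  · intro hE
    let ξ : ∀ a, X.V a →ₗ[k] Y.V a := fun a => p a ∘ₗ θ' a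
    have hξ : IsHom X Y ξ := isHom_comp hθ' hp
    have hθ'ι : ∀ a x, θ' a (ι a x) = 0 := fun a x => hιinj a (by rw [hιθ', hθι, map_zero])
    -- kernel of ξ
    have hker : ∀ a x, ξ a x = 0 → θ a x = 0 := by
      let g : ∀ a, X.V a →ₗ[k] X.V a := fun a => ι a ∘ₗ i a ∘ₗ ξ a
      have hle := hθmin g ⟨isHom_comp (isHom_comp hξ hi) hι, by
        intro a x
        simp only [g, ξ, LinearMap.comp_apply]
        rw [hθ'ι, map_zero, map_zero, map_zero], a₀, x₀, by
        intro h
        apply hne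
        have h2 := hιinj a₀ (h.trans (map_zero _).symm)
        rw [← hpi a₀ (p a₀ (θ' a₀ x₀))]
        exact (congrArg (p a₀) h2).trans (map_zero _)⟩
      have hkk : ∀ a, LinearMap.ker (θ a) ≤ LinearMap.ker (g a) := by
        intro a x hx
        rw [LinearMap.mem_ker] at hx ⊢
        have : θ' a x = 0 := hιinj a (by rw [hιθ', hx, map_zero])
        simp [g, ξ, this]
      have hle2 : ∀ a ∈ Finset.univ, Module.finrank k (LinearMap.range (g a)) ≤
          Module.finrank k (LinearMap.range (θ a)) := by
        intro a _
        have e1 := LinearMap.finrank_range_add_finrank_ker (g a)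
        have e2 := LinearMap.finrank_range_add_finrank_ker (θ a)
        have e3 := Submodule.finrank_mono (hkk a)
        omega
      have heq := (Finset.sum_eq_sum_iff_of_le hle2).1 (le_antisymm (Finset.sum_le_sum hle2) hle)
      intro a x hx
      have e1 := LinearMap.finrank_range_add_finrank_ker (g a)
      have e2 := LinearMap.finrank_range_add_finrank_ker (θ a)
      have e3 := heq a (Finset.mem_univ a)
      have e4 := Submodule.eq_of_le_of_finrank_eq (hkk a) (by omega)
      have : x ∈ LinearMap.ker (g a) := by
        rw [LinearMap.mem_ker]; simp [g, hx]
      rw [← e4] at this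
      exact this
    have hπ : ∀ a, ∃ π : X.V a →ₗ[k] Y.V a, ∀ x, π (ι a x) = p a x := by
      intro a
      obtain ⟨π, hπ⟩ := LinearMap.exists_extend (p := LinearMap.ker (θ a)) (p a)
      exact ⟨π, fun x => LinearMap.congr_fun hπ x⟩
    choose π hπ using hπ
    have hφ : ∀ (a b : Q) (m : a ⟶ b), ∃ φ : Y.V a →ₗ[k] Y.V b, ∀ x, φ (ξ a x) =
        (π b ∘ₗ X.map m - Y.map m ∘ₗ π a) x := by
      intro a b m
      apply qr_factor
      intro x hx
      obtain ⟨x', rfl⟩ : ∃ x' : K.V a, ι a x' = x := ⟨⟨x, hker a x hx⟩, rfl⟩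
      simp only [LinearMap.sub_apply, LinearMap.comp_apply]
      rw [hπ, ← hι, hπ, hp, sub_self]
    choose φ hφ using hφ
    obtain ⟨σ, hσ⟩ := hE φ
    let τ : ∀ a, X.V a →ₗ[k] Y.V a := fun a => π a - σ a ∘ₗ ξ a
    have hτ : IsHom X Y τ := by
      intro a b m x
      have h1 := hφ a b m x
      rw [hσ, ← hξ] at h1
      simp only [LinearMap.sub_apply, LinearMap.comp_apply] at h1
      simp only [τ, LinearMap.sub_apply, LinearMap.comp_apply, map_sub]
      rw [sub_eq_sub_iff_add_eq_add] at h1 ⊢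
      rw [add_comm _ (σ b _), h1, add_comm]
    have hτi : ∀ a y, τ a (ι a (i a y)) = y := by
      intro a y
      simp only [τ, ξ, LinearMap.sub_apply, LinearMap.comp_apply]
      rw [hπ, hpi, hθ'ι, map_zero, map_zero, sub_zero]
    rcases hX.2 (fun a => ι a ∘ₗ i a ∘ₗ τ a) (isHom_comp (isHom_comp hτ hi) hι) (by
      intro a x
      simp only [LinearMap.comp_apply]
      rw [hτi]) with h1 | h1
    · obtain ⟨a, ha⟩ := hYnt
      obtain ⟨y, hy⟩ := exists_ne (0 : Y.V a)
      apply hy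
      have h2 := h1 a (ι a (i a y))
      simp only [LinearMap.comp_apply] at h2
      rw [hτi] at h2
      rw [← hτi a y, h2, map_zero]
    · obtain ⟨a, x, hax⟩ := hθ0
      apply hax
      rw [← h1 a x]
      exact hθι _ _

section main
variable [Fintype Q] [∀ a b : Q, Fintype (a ⟶ b)]

theorem dv_ne {X : QRep k Q} (hX : Indec X) : dv X ≠ 0 := by
  obtain ⟨a, ha⟩ := hX.1
  intro h
  have h1 := congrFun h a
  simp only [dv, dim, Pi.zero_apply, Nat.cast_eq_zero] at h1
  exact (Module.finrank_pos (R := k) (M := X.V a)).ne' h1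

theorem h_self (X : QRep k Q) : h X X = Module.finrank k (End X) := by
  have : LinearMap.ker (d X X) = Subalgebra.toSubmodule (End X) := by
    ext f
    rw [mem_ker_d]
    rfl
  rw [h, this]
  rfl

theorem brick [IsAlgClosed k] (hdyn : ∀ x : Q → ℚ, x ≠ 0 → 0 < eu x x) (n : ℕ) :
    ∀ X : QRep k Q, tot X = n → Indec X → ExtVan X X ∧ eu (dv X) (dv X) = 1 := by
  induction n using Nat.strong_induction_on with
  | _ n ih =>
  intro X hn hX
  have hsq : ∀ t : End X, t * t = 0 → t = 0 := by
    intro t ht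
    by_contra hne
    obtain ⟨Y, hY, hlt, hE⟩ := ringel hX ⟨t.1, t.2, fun a x => by
      have := LinearMap.congr_fun (congrFun (congrArg Subtype.val ht) a) x
      simpa using this, by
      by_contra hc
      push Not at hc
      apply hne
      ext a x
      simpa using hc a x⟩
    exact hE (ih (tot Y) (hn ▸ hlt) Y rfl hY).1
  have hred : IsReduced (End X) := by
    constructor
    intro t ht
    by_contra hne
    obtain ⟨m, hm⟩ : ∃ m, t ^ (m+1) = 0 ∧ t ^ m ≠ 0 := by
      classical
      have hm := Nat.find_spec ht
      have hmin := fun m => Nat.find_min ht (m := m)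
      rcases hN : Nat.find ht with _ | N
      · rw [hN] at hm
        exact absurd (by rw [← mul_one t, ← pow_zero t, hm, mul_zero]) hne
      · rw [hN] at hm
        exact ⟨N, hm, hmin N (by omega)⟩
    have hm0 : m ≠ 0 := by
      rintro rfl
      apply hne; simpa using hm.1
    apply hm.2
    apply hsq
    rw [← pow_add, show m + m = (m + 1) + (m - 1) by omega, pow_add, hm.1, zero_mul]
  have hnt : Nontrivial (End X) := by
    obtain ⟨a, ha⟩ := hX.1
    obtain ⟨x, hx⟩ := exists_ne (0 : X.V a)
    refine ⟨1, 0, fun h => hx ?_⟩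
    have := LinearMap.congr_fun (congrFun (congrArg Subtype.val h) a) x
    simpa using this
  have h1 : h X X = 1 := by
    rw [h_self]
    refine finrank_eq_one (1 : End X) one_ne_zero ?_
    intro t
    obtain ⟨c, hc⟩ := spectrum.nonempty_of_isAlgClosed_of_finiteDimensional k t
    refine ⟨c, ?_⟩
    rcases end_unit_or_nilp hX (algebraMap k (End X) c - t) with h | h
    · exact absurd h hc
    · have := h.eq_zero
      rw [sub_eq_zero] at this
      rw [← this, Algebra.algebraMap_eq_smul_one]
  obtain ⟨z, hz⟩ := eu_int X X
  have hpos := hdyn _ (dv_ne hX)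
  rw [hz] at hpos
  have hz1 : 1 ≤ z := by exact_mod_cast hpos
  have hE : ExtVan X X := by
    apply ext_of_euler
    rw [h1, hz]
    exact_mod_cast hz1
  refine ⟨hE, ?_⟩
  rw [← euler_of_ext _ _ hE, h1, Nat.cast_one]

theorem main [IsAlgClosed k] (hdyn : ∀ x : Q → ℚ, x ≠ 0 → 0 < eu x x) {U V : QRep k Q}
    (hU : Indec U) (hV : Indec V) (hE : ExtVan V U)
    (f : ∀ a, U.V a →ₗ[k] V.V a) (hf : IsHom U V f) (hne : ∃ a x, f a x ≠ 0) :
    h U V = 1 := by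
  obtain ⟨hUE, hU1⟩ := brick hdyn _ U rfl hU
  obtain ⟨hVE, hV1⟩ := brick hdyn _ V rfl hV
  have hUV : ExtVan U V := by
    rcases mono_or_epi hU hV hE f hf hne with hm | hm
    · intro φ
      have : ∀ (a b : Q) (m : a ⟶ b), ∃ ψ : V.V a →ₗ[k] V.V b, ∀ x, ψ (f a x) = φ a b m x := by
        intro a b m
        apply qr_factor
        intro x hx
        rw [hm a (hx.trans (map_zero _).symm), map_zero]
      choose ψ hψ using this
      obtain ⟨σ, hσ⟩ := hVE ψ
      refine ⟨fun a => σ a ∘ₗ f a, fun a b m x => ?_⟩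
      rw [← hψ, hσ, LinearMap.comp_apply, LinearMap.comp_apply, hf]
    · intro φ
      have hr : ∀ a, ∃ r : V.V a →ₗ[k] U.V a, ∀ x, f a (r x) = x := by
        intro a
        obtain ⟨r, hr⟩ := (f a).exists_rightInverse_of_surjective (LinearMap.range_eq_top.2 (hm a))
        exact ⟨r, fun x => LinearMap.congr_fun hr x⟩
      choose r hr using hr
      obtain ⟨σ, hσ⟩ := hUE (fun a b m => r b ∘ₗ φ a b m)
      refine ⟨fun a => f a ∘ₗ σ a, fun a b m x => ?_⟩
      have := congrArg (f b) (hσ a b m x)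
      rw [LinearMap.comp_apply, hr, map_sub, hf] at this
      exact this
  have e1 := euler_of_ext _ _ hUV
  have e2 := euler_of_ext _ _ hE
  by_cases huv : dv U = dv V
  · rw [← huv, hU1] at e1
    exact_mod_cast e1
  · have hp := hdyn _ (sub_ne_zero.2 huv)
    rw [eu_sub, hU1, hV1, ← e1, ← e2] at hp
    have h2 : (h U V : ℚ) < 2 := by
      have : (0:ℚ) ≤ h V U := Nat.cast_nonneg _
      linarith
    have h3 : h U V < 2 := by exact_mod_cast h2
    have h4 : 0 < h U V := by
      obtain ⟨a, x, hx⟩ := hne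
      have : Nontrivial (LinearMap.ker (d U V)) := by
        refine ⟨⟨f, mem_ker_d.2 hf⟩, 0, fun h => hx ?_⟩
        have := LinearMap.congr_fun (congrFun (congrArg Subtype.val h) a) x
        simpa using this
      exact Module.finrank_pos
    omega

end main

end QRep

namespace QRep

set_option linter.unusedVariables false

variable {k : Type} [Field k] {Q : Type} [Quiver.{1} Q]

/-- The quiver representation of a functor. -/
def ofF (F : Paths Q ⥤ ModuleCat.{0} k) (hF : ∀ q : Paths Q, FiniteDimensional k (F.obj q)) :
    QRep k Q where
  V a := F.obj ((Paths.of Q).obj a)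
  fd a := hF _
  map m := (F.map ((Paths.of Q).map m)).hom

/-- natural transformations from compatible families -/
def mkNat (F G : Paths Q ⥤ ModuleCat.{0} k)
    (f : ∀ a : Q, F.obj ((Paths.of Q).obj a) →ₗ[k] G.obj ((Paths.of Q).obj a))
    (hf : ∀ (a b : Q) (m : a ⟶ b) x, f b ((F.map ((Paths.of Q).map m)).hom x) =
      (G.map ((Paths.of Q).map m)).hom (f a x)) : F ⟶ G :=
  Paths.liftNatTrans (fun v => ModuleCat.ofHom (f v)) (by
    intro u v m
    ext x
    exact hf u v m x)

theorem mkNat_app (F G : Paths Q ⥤ ModuleCat.{0} k)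
    (f : ∀ a : Q, F.obj ((Paths.of Q).obj a) →ₗ[k] G.obj ((Paths.of Q).obj a)) (hf) (a : Q) :
    (mkNat F G f hf).app ((Paths.of Q).obj a) = ModuleCat.ofHom (f a) := rfl

theorem nat_isHom {F G : Paths Q ⥤ ModuleCat.{0} k} (hF hG) (η : F ⟶ G) :
    IsHom (ofF F hF) (ofF G hG) (fun a => (η.app ((Paths.of Q).obj a)).hom) := by
  intro a b m x
  have := η.naturality ((Paths.of Q).map m)
  exact LinearMap.congr_fun (congrArg ModuleCat.Hom.hom this) x

theorem nat_ext {F G : Paths Q ⥤ ModuleCat.{0} k} {η ζ : F ⟶ G}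
    (h : ∀ (a : Q) x, (η.app ((Paths.of Q).obj a)).hom x = (ζ.app ((Paths.of Q).obj a)).hom x) :
    η = ζ := by
  apply NatTrans.ext
  funext a
  ext x
  exact h a x

noncomputable def homEquiv (F G : Paths Q ⥤ ModuleCat.{0} k) (hF hG) :
    (F ⟶ G) ≃ₗ[k] LinearMap.ker (d (ofF F hF) (ofF G hG)) where
  toFun η := ⟨fun a => (η.app ((Paths.of Q).obj a)).hom, mem_ker_d.2 (nat_isHom hF hG η)⟩
  invFun f := mkNat F G f.1 (mem_ker_d.1 f.2)
  map_add' η ζ := rfl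
  map_smul' c η := rfl
  left_inv η := nat_ext fun a x => rfl
  right_inv f := rfl

theorem indec_of {F : Paths Q ⥤ ModuleCat.{0} k} (hF)
    (hind : ¬ IsZero F ∧ ∀ A B : Paths Q ⥤ ModuleCat.{0} k,
      Nonempty (F ≅ A ⊞ B) → IsZero A ∨ IsZero B) : Indec (ofF F hF) := by
  constructor
  · by_contra hc
    apply hind.1
    rw [IsZero.iff_id_eq_zero]
    apply nat_ext
    intro a x
    push Not at hc
    have := hc a
    exact (Subsingleton.elim (α := (ofF F hF).V a) _ _)
  · intro e he he2
    let η : F ⟶ F := mkNat F F e he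
    have hη : η ≫ η = η := nat_ext fun a x => he2 a x
    have hη' : (𝟙 F - η) ≫ (𝟙 F - η) = 𝟙 F - η := by
      simp [hη]
    obtain ⟨A, i, p, hip, hpi⟩ := IsIdempotentComplete.idempotents_split F η hη
    obtain ⟨B, j, q, hjq, hqj⟩ := IsIdempotentComplete.idempotents_split F (𝟙 F - η) hη'
    have hiq : i ≫ q = 0 := by
      have : i ≫ q = (i ≫ p) ≫ i ≫ q ≫ (j ≫ q) := by rw [hip, hjq]; simp
      have h2 : (i ≫ p) ≫ i ≫ q ≫ (j ≫ q) = i ≫ (p ≫ i) ≫ (q ≫ j) ≫ q := by simp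
      rw [this, h2, hpi, hqj, ← Category.assoc η, Preadditive.comp_sub, hη]
      simp
    have hjp : j ≫ p = 0 := by
      have : j ≫ p = (j ≫ q) ≫ j ≫ p ≫ (i ≫ p) := by rw [hip, hjq]; simp
      have h2 : (j ≫ q) ≫ j ≫ p ≫ (i ≫ p) = j ≫ (q ≫ j) ≫ (p ≫ i) ≫ p := by simp
      rw [this, h2, hpi, hqj, ← Category.assoc _ η, Preadditive.sub_comp, hη]
      simp
    let b : BinaryBicone A B :=
      { pt := F, fst := p, snd := q, inl := i, inr := j, inl_fst := hip, inl_snd := hiq,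
        inr_fst := hjp, inr_snd := hjq }
    have hb : b.IsBilimit := isBinaryBilimitOfTotal b (by
      change p ≫ i + q ≫ j = 𝟙 F
      rw [hpi, hqj]; abel)
    rcases hind.2 A B ⟨biprod.uniqueUpToIso A B hb⟩ with h | h
    · left
      have h0 : η = 0 := by rw [← hpi, h.eq_of_tgt p 0, zero_comp]
      intro a x
      exact LinearMap.congr_fun (congrArg ModuleCat.Hom.hom
        (congrArg (fun ζ : F ⟶ F => ζ.app ((Paths.of Q).obj a)) h0)) x
    · right
      have h0 : 𝟙 F = η := by rw [← sub_eq_zero, ← hqj, h.eq_of_tgt q 0, zero_comp]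
      intro a x
      exact (LinearMap.congr_fun (congrArg ModuleCat.Hom.hom
        (congrArg (fun ζ : F ⟶ F => ζ.app ((Paths.of Q).obj a)) h0)) x).symm

/-- extension given by a cocycle -/
noncomputable def extF (U V : Paths Q ⥤ ModuleCat.{0} k)
    (φ : ∀ (a b : Q), (a ⟶ b) →
      (V.obj ((Paths.of Q).obj a) →ₗ[k] U.obj ((Paths.of Q).obj b))) :
    Paths Q ⥤ ModuleCat.{0} k :=
  Paths.lift
    { obj := fun a => ModuleCat.of k (U.obj ((Paths.of Q).obj a) × V.obj ((Paths.of Q).obj a))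
      map := fun {a b} m => ModuleCat.ofHom
        (((U.map ((Paths.of Q).map m)).hom ∘ₗ LinearMap.fst k _ _ + φ a b m ∘ₗ LinearMap.snd k _ _).prod
          ((V.map ((Paths.of Q).map m)).hom ∘ₗ LinearMap.snd k _ _)) }

theorem extF_map (U V : Paths Q ⥤ ModuleCat.{0} k) (φ) {a b : Q} (m : a ⟶ b)
    (x : U.obj ((Paths.of Q).obj a) × V.obj ((Paths.of Q).obj a)) :
    ((extF U V φ).map ((Paths.of Q).map m)).hom x =
      ((U.map ((Paths.of Q).map m)).hom x.1 + φ a b m x.2,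
        (V.map ((Paths.of Q).map m)).hom x.2) := by
  have : (extF U V φ).map ((Paths.of Q).map m) = _ := Paths.lift_toPath _ m
  rw [this]
  rfl

theorem extVan_of {U V : Paths Q ⥤ ModuleCat.{0} k} (hU hV) (hE : Ext1Zero V U) :
    ExtVan (ofF V hV) (ofF U hU) := by
  intro φ'
  let φ : ∀ (a b : Q), (a ⟶ b) →
      (V.obj ((Paths.of Q).obj a) →ₗ[k] U.obj ((Paths.of Q).obj b)) := φ'
  let E := extF U V φ
  let ι : U ⟶ E := mkNat U E (fun a => LinearMap.inl k (U.obj ((Paths.of Q).obj a)) (V.obj ((Paths.of Q).obj a))) (by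
    intro a b m x
    refine Eq.trans ?_ (extF_map U V φ m (x, 0)).symm
    refine Prod.ext ?_ ?_
    · change _ = _ + φ a b m 0
      rw [map_zero, add_zero]
      rfl
    · exact (map_zero (V.map ((Paths.of Q).map m)).hom).symm)
  let p : E ⟶ V := mkNat E V (fun a => LinearMap.snd k (U.obj ((Paths.of Q).obj a)) (V.obj ((Paths.of Q).obj a))) (by
    intro a b m x
    exact congrArg Prod.snd (extF_map U V φ m x))
  have w : ι ≫ p = 0 := nat_ext fun a x => rfl
  have hm : Mono ι := by
    constructor
    intro Z g h hgh
    apply nat_ext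
    intro a x
    have := LinearMap.congr_fun (congrArg ModuleCat.Hom.hom
        (congrArg (fun ζ : Z ⟶ E => ζ.app ((Paths.of Q).obj a)) hgh)) x
    exact congrArg Prod.fst this
  have he : Epi p := by
    apply +allowSynthFailures NatTrans.epi_of_epi_app
    intro a
    rw [ModuleCat.epi_iff_surjective]
    intro x
    exact ⟨((0 : U.obj a), x), rfl⟩
  have hS : (ShortComplex.mk ι p w).ShortExact := by
    refine ShortComplex.ShortExact.mk' (ShortComplex.exact_of_f_is_kernel _ ?_) hm he
    refine KernelFork.IsLimit.ofι' _ _ ?_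
    intro Z g hg
    have h2 : ∀ (a : Q) x, ((g.app ((Paths.of Q).obj a)).hom x :
        U.obj ((Paths.of Q).obj a) × V.obj ((Paths.of Q).obj a)).2 = 0 := fun a x =>
      LinearMap.congr_fun (congrArg ModuleCat.Hom.hom
        (congrArg (fun ζ : Z ⟶ V => ζ.app ((Paths.of Q).obj a)) hg)) x
    refine ⟨mkNat Z U (fun a => LinearMap.fst k (U.obj ((Paths.of Q).obj a)) (V.obj ((Paths.of Q).obj a)) ∘ₗ (g.app ((Paths.of Q).obj a)).hom) ?_, ?_⟩
    · intro a b m x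
      have h3 := LinearMap.congr_fun (congrArg ModuleCat.Hom.hom
        (g.naturality ((Paths.of Q).map m))) x
      have h4 := congrArg Prod.fst (h3.trans (extF_map U V φ m _))
      refine Eq.trans h4 ?_
      have h7 : ∀ (A : U.obj ((Paths.of Q).obj b)) (t : V.obj ((Paths.of Q).obj a)), t = 0 →
          A + φ a b m t = A := by
        intro A t ht
        rw [ht, map_zero, add_zero]
      exact h7 _ _ (h2 a x)
    · apply nat_ext
      intro a x
      exact Prod.ext rfl (h2 a x).symm
  obtain ⟨r, hr⟩ := hE E ι p w hS
  have hr1 : ∀ (a : Q) (u : U.obj ((Paths.of Q).obj a)),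
      (r.app ((Paths.of Q).obj a)).hom
        (LinearMap.inl k (U.obj ((Paths.of Q).obj a)) (V.obj ((Paths.of Q).obj a)) u) = u :=
    fun a u => LinearMap.congr_fun (congrArg ModuleCat.Hom.hom
      (congrArg (fun ζ : U ⟶ U => ζ.app ((Paths.of Q).obj a)) hr)) u
  let ρ : ∀ a : Q, V.obj ((Paths.of Q).obj a) →ₗ[k] U.obj ((Paths.of Q).obj a) := fun a =>
    (r.app ((Paths.of Q).obj a)).hom ∘ₗ
      LinearMap.inr k (U.obj ((Paths.of Q).obj a)) (V.obj ((Paths.of Q).obj a))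
  have key : ∀ (a b : Q) (m : a ⟶ b) (x : V.obj ((Paths.of Q).obj a)),
      φ a b m x + ρ b ((V.map ((Paths.of Q).map m)).hom x) =
        (U.map ((Paths.of Q).map m)).hom (ρ a x) := by
    intro a b m x
    have h3 := LinearMap.congr_fun (congrArg ModuleCat.Hom.hom
      (r.naturality ((Paths.of Q).map m)))
        (LinearMap.inr k (U.obj ((Paths.of Q).obj a)) (V.obj ((Paths.of Q).obj a)) x)
    have h4 := extF_map U V φ m
      (LinearMap.inr k (U.obj ((Paths.of Q).obj a)) (V.obj ((Paths.of Q).obj a)) x)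
    have h5 := (congrArg (r.app ((Paths.of Q).obj b)).hom h4).symm.trans h3
    refine Eq.trans ?_ h5
    have h6 := hr1 b (φ a b m x)
    conv_lhs => rw [← h6]
    refine (map_add (r.app ((Paths.of Q).obj b)).hom _ _).symm.trans ?_
    congr 1
    refine Prod.ext ?_ ?_
    · change φ a b m x + 0 = (U.map ((Paths.of Q).map m)).hom 0 + φ a b m x
      rw [map_zero, add_zero, zero_add]
    · change 0 + (V.map ((Paths.of Q).map m)).hom x = _
      rw [zero_add]
      rfl
  have key2 : ∀ (a b : Q) (m : a ⟶ b) (x : V.obj ((Paths.of Q).obj a)),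
      φ a b m x = -(ρ b ((V.map ((Paths.of Q).map m)).hom x)) -
        (U.map ((Paths.of Q).map m)).hom (-(ρ a x)) := by
    intro a b m x
    rw [map_neg, ← key]
    abel
  exact ⟨fun a => -ρ a, fun a b m x => key2 a b m x⟩

end QRep
/-- Let `Q` be a quiver whose underlying graph is a simply-laced Dynkin
diagram and let `U, V` be indecomposable `kQ`-modules with `Hom_{kQ}(U,V) ≠ 0` and
`Ext¹_{kQ}(V,U) = 0`.  Then `dim_k Hom_{kQ}(U,V) = 1`.
Here `kQ`-modules are realised as representations of `Q`, i.e. functors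
`Paths Q ⥤ ModuleCat k`; "the underlying graph of `Q` is a simply-laced Dynkin diagram" is
expressed by connectedness together with positive definiteness of the Tits form, which
characterises the simply-laced Dynkin diagrams. -/
theorem hom_dim_one_of_ext_vanishing
    (k : Type) [Field k] [IsAlgClosed k]
    -- a finite quiver Q:
    (Q : Type) [Quiver.{1} Q] [Fintype Q] [∀ a b : Q, Fintype (a ⟶ b)]
    -- whose underlying graph is connected ...
    (hconn : ∀ a b : Quiver.Symmetrify Q, Nonempty (Quiver.Path a b))
    -- ... and is a simply-laced Dynkin diagram (positive definite Tits form):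
    (hdynkin : ∀ x : Q → ℚ, x ≠ 0 →
      0 < (∑ a : Q, x a * x a) -
        ∑ a : Q, ∑ b : Q, (Fintype.card (a ⟶ b) : ℚ) * (x a * x b))
    -- U and V are finite-dimensional representations of Q (i.e. kQ-modules):
    (U V : Paths Q ⥤ ModuleCat.{0} k)
    (hUfd : ∀ q : Paths Q, FiniteDimensional k (U.obj q))
    (hVfd : ∀ q : Paths Q, FiniteDimensional k (V.obj q))
    -- U and V are indecomposable:
    (hUind : ¬ IsZero U ∧ ∀ A B : Paths Q ⥤ ModuleCat.{0} k,
      Nonempty (U ≅ A ⊞ B) → IsZero A ∨ IsZero B)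
    (hVind : ¬ IsZero V ∧ ∀ A B : Paths Q ⥤ ModuleCat.{0} k,
      Nonempty (V ≅ A ⊞ B) → IsZero A ∨ IsZero B)
    -- Hom_{kQ}(U,V) ≠ 0:
    (hHom : ∃ η : U ⟶ V, η ≠ 0)
    -- Ext¹_{kQ}(V,U) = 0:
    (hExt : Ext1Zero V U) :
    -- conclusion: dim_k Hom_{kQ}(U,V) = 1:
    Module.finrank k (U ⟶ V) = 1 := by
  rw [(QRep.homEquiv U V hUfd hVfd).finrank_eq]
  obtain ⟨η, hη⟩ := hHom
  refine QRep.main (U := QRep.ofF U hUfd) (V := QRep.ofF V hVfd) hdynkin (QRep.indec_of hUfd hUind)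
    (QRep.indec_of hVfd hVind) (QRep.extVan_of hUfd hVfd hExt) _ (QRep.nat_isHom hUfd hVfd η) ?_
  by_contra hc
  push Not at hc
  exact hη (QRep.nat_ext fun a x => hc a x)
end

section
/- Let Q be a simply-laced Dynkin quiver, and let M, M* be indecomposable kQ-modules with dim_k Ext¹_{kQ}(M, M*) = 1 and Ext¹_{kQ}(M*, M) = 0. Let 0 → M* → X → M → 0 be the (unique up to isomorphism) non-split extension. Then X is the direct sum, each with multiplicity one, of all indecomposable kQ-modules V satisfying Hom(M*, V) ≠ 0, Hom(V, M) ≠ 0, Ext¹(V, M*) = 0 and Ext¹(M, V) = 0. -/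
open CategoryTheory CategoryTheory.Limits

attribute [local instance] CategoryTheory.Abelian.hasFiniteBiproducts

namespace DynkinMid

section part1

variable {k : Type} [Field k] {Q : Type} [Quiver.{1} Q]

/-- families of linear maps -/
abbrev C0 (V W : Paths Q ⥤ ModuleCat.{0} k) : Type :=
  ∀ a : Q, V.obj ((Paths.of Q).obj a) ⟶ W.obj ((Paths.of Q).obj a)

/-- cocycles -/
abbrev C1 (V W : Paths Q ⥤ ModuleCat.{0} k) : Type 1 :=
  ∀ a b : Q, ∀ _ : a ⟶ b, V.obj ((Paths.of Q).obj a) ⟶ W.obj ((Paths.of Q).obj b)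

/-- the differential -/
def dd (V W : Paths Q ⥤ ModuleCat.{0} k) : C0 V W →ₗ[k] C1 V W where
  toFun φ := fun a b α => φ a ≫ W.map ((Paths.of Q).map α) - V.map ((Paths.of Q).map α) ≫ φ b
  map_add' φ ψ := by
    funext a b α
    simp only [Pi.add_apply, Preadditive.add_comp, Preadditive.comp_add]
    abel
  map_smul' c φ := by
    funext a b α
    simp only [Pi.smul_apply, Linear.smul_comp, Linear.comp_smul, smul_sub, RingHom.id_apply]

theorem dd_apply (V W : Paths Q ⥤ ModuleCat.{0} k) (φ : C0 V W) (a b : Q) (α : a ⟶ b) :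
    dd V W φ a b α = φ a ≫ W.map ((Paths.of Q).map α) - V.map ((Paths.of Q).map α) ≫ φ b := rfl

/-- `Ext¹ = 0`, cocycle version -/
def E0 (V W : Paths Q ⥤ ModuleCat.{0} k) : Prop := ∀ c : C1 V W, ∃ φ, dd V W φ = c

theorem nat_aux {V W : Paths Q ⥤ ModuleCat.{0} k} (φ : ∀ a : Paths Q, V.obj a ⟶ W.obj a)
    (h : ∀ (a b : Q) (α : a ⟶ b), V.map ((Paths.of Q).map α) ≫ φ ((Paths.of Q).obj b) =
      φ ((Paths.of Q).obj a) ≫ W.map ((Paths.of Q).map α)) {a b : Paths Q} (f : a ⟶ b) :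
    V.map f ≫ φ b = φ a ≫ W.map f := by
  refine Paths.induction (V := Q)
      (P := fun {a b} f => V.map f ≫ φ b = φ a ≫ W.map f) ?_ ?_ f
  · intro v
    simp
  · intro u v w p q ih
    rw [V.map_comp, W.map_comp, Category.assoc, h, ← Category.assoc, ih, Category.assoc]

/-- a family commuting with arrows is a morphism -/
def mkHom {V W : Paths Q ⥤ ModuleCat.{0} k} (φ : C0 V W) (h : dd V W φ = 0) : V ⟶ W where
  app a := φ a
  naturality := fun _ _ f => nat_aux (fun a : Paths Q => φ a) (fun a b α =>
    (sub_eq_zero.1 (congrFun (congrFun (congrFun h a) b) α)).symm) f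

theorem mkHom_app {V W : Paths Q ⥤ ModuleCat.{0} k} (φ : C0 V W) (h : dd V W φ = 0) (a : Q) :
    (mkHom φ h).app ((Paths.of Q).obj a) = φ a := rfl

/-- the family of a morphism -/
def fam {V W : Paths Q ⥤ ModuleCat.{0} k} (f : V ⟶ W) : C0 V W :=
  fun a => f.app ((Paths.of Q).obj a)

theorem fam_mkHom {V W : Paths Q ⥤ ModuleCat.{0} k} (φ : C0 V W) (h : dd V W φ = 0) :
    fam (mkHom φ h) = φ := rfl

theorem fam_ext {V W : Paths Q ⥤ ModuleCat.{0} k} {f g : V ⟶ W} (h : fam f = fam g) : f = g := by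
  ext a : 2
  exact congrFun h a

/-- composition of families -/
def cc {U V W : Paths Q ⥤ ModuleCat.{0} k} (φ : C0 U V) (ψ : C0 V W) : C0 U W :=
  fun a => φ a ≫ ψ a

/-- left action -/
def lc {U V W : Paths Q ⥤ ModuleCat.{0} k} (φ : C0 U V) (ψ : C1 V W) : C1 U W :=
  fun a b α => φ a ≫ ψ a b α

/-- right action -/
def rc {U V W : Paths Q ⥤ ModuleCat.{0} k} (φ : C1 U V) (ψ : C0 V W) : C1 U W :=
  fun a b α => φ a b α ≫ ψ b

/-- identity -/
def one (V : Paths Q ⥤ ModuleCat.{0} k) : C0 V V := fun _ => 𝟙 _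

variable {T U V W : Paths Q ⥤ ModuleCat.{0} k}

theorem fam_comp (f : U ⟶ V) (g : V ⟶ W) : fam (f ≫ g) = cc (fam f) (fam g) := rfl
theorem fam_id : fam (𝟙 U) = one U := rfl
theorem fam_zero : fam (0 : U ⟶ V) = 0 := rfl
theorem fam_add (f g : U ⟶ V) : fam (f + g) = fam f + fam g := rfl
theorem fam_sub (f g : U ⟶ V) : fam (f - g) = fam f - fam g := rfl
theorem fam_smul (c : k) (f : U ⟶ V) : fam (c • f) = c • fam f := rfl

theorem cc_assoc (φ : C0 T U) (ψ : C0 U V) (χ : C0 V W) : cc (cc φ ψ) χ = cc φ (cc ψ χ) := by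
  funext a; simp [cc]
theorem lc_assoc (φ : C0 T U) (ψ : C0 U V) (χ : C1 V W) : lc (cc φ ψ) χ = lc φ (lc ψ χ) := by
  funext a b α; simp [cc, lc]
theorem rc_assoc (φ : C1 T U) (ψ : C0 U V) (χ : C0 V W) : rc (rc φ ψ) χ = rc φ (cc ψ χ) := by
  funext a b α; simp [cc, rc]
theorem lrc_assoc (φ : C0 T U) (ψ : C1 U V) (χ : C0 V W) : rc (lc φ ψ) χ = lc φ (rc ψ χ) := by
  funext a b α; simp [lc, rc]
theorem one_cc (φ : C0 U V) : cc (one U) φ = φ := by funext a; simp [cc, one]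
theorem cc_one (φ : C0 U V) : cc φ (one V) = φ := by funext a; simp [cc, one]
theorem one_lc (φ : C1 U V) : lc (one U) φ = φ := by funext a b α; simp [lc, one]
theorem rc_one (φ : C1 U V) : rc φ (one V) = φ := by funext a b α; simp [rc, one]
theorem zero_cc (φ : C0 U V) : cc (0 : C0 T U) φ = 0 := by funext a; simp [cc]
theorem cc_zero (φ : C0 U V) : cc φ (0 : C0 V W) = 0 := by funext a; simp [cc]
theorem zero_lc (φ : C1 U V) : lc (0 : C0 T U) φ = 0 := by funext a b α; simp [lc]
theorem lc_zero (φ : C0 U V) : lc φ (0 : C1 V W) = 0 := by funext a b α; simp [lc]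
theorem zero_rc (φ : C0 U V) : rc (0 : C1 T U) φ = 0 := by funext a b α; simp [rc]
theorem rc_zero (φ : C1 U V) : rc φ (0 : C0 V W) = 0 := by funext a b α; simp [rc]
theorem add_cc (φ φ' : C0 T U) (ψ : C0 U V) : cc (φ + φ') ψ = cc φ ψ + cc φ' ψ := by
  funext a; simp [cc]
theorem cc_add (φ : C0 T U) (ψ ψ' : C0 U V) : cc φ (ψ + ψ') = cc φ ψ + cc φ ψ' := by
  funext a; simp [cc]
theorem sub_cc (φ φ' : C0 T U) (ψ : C0 U V) : cc (φ - φ') ψ = cc φ ψ - cc φ' ψ := by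
  funext a; simp [cc]
theorem cc_sub (φ : C0 T U) (ψ ψ' : C0 U V) : cc φ (ψ - ψ') = cc φ ψ - cc φ ψ' := by
  funext a; simp [cc]
theorem add_lc (φ φ' : C0 T U) (ψ : C1 U V) : lc (φ + φ') ψ = lc φ ψ + lc φ' ψ := by
  funext a b α; simp [lc]
theorem sub_lc (φ φ' : C0 T U) (ψ : C1 U V) : lc (φ - φ') ψ = lc φ ψ - lc φ' ψ := by
  funext a b α; simp [lc]
theorem lc_sub (φ : C0 T U) (ψ ψ' : C1 U V) : lc φ (ψ - ψ') = lc φ ψ - lc φ ψ' := by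
  funext a b α; simp [lc]
theorem sub_rc (φ φ' : C1 T U) (ψ : C0 U V) : rc (φ - φ') ψ = rc φ ψ - rc φ' ψ := by
  funext a b α; simp [rc]
theorem rc_add (φ : C1 T U) (ψ ψ' : C0 U V) : rc φ (ψ + ψ') = rc φ ψ + rc φ ψ' := by
  funext a b α; simp [rc]
theorem rc_sub (φ : C1 T U) (ψ ψ' : C0 U V) : rc φ (ψ - ψ') = rc φ ψ - rc φ ψ' := by
  funext a b α; simp [rc]
theorem rc_smul (c : k) (φ : C1 T U) (ψ : C0 U V) : rc φ (c • ψ) = c • rc φ ψ := by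
  funext a b α; simp [rc]
theorem cc_smul (c : k) (φ : C0 T U) (ψ : C0 U V) : cc φ (c • ψ) = c • cc φ ψ := by
  funext a; simp [cc]
theorem smul_cc (c : k) (φ : C0 T U) (ψ : C0 U V) : cc (c • φ) ψ = c • cc φ ψ := by
  funext a; simp [cc]

/-- Leibniz rule -/
theorem dd_cc (φ : C0 T U) (ψ : C0 U V) :
    dd T V (cc φ ψ) = rc (dd T U φ) ψ + lc φ (dd U V ψ) := by
  funext a b α
  simp [dd_apply, cc, rc, lc, Preadditive.sub_comp, Preadditive.comp_sub]

theorem dd_fam (f : U ⟶ V) : dd U V (fam f) = 0 := by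
  funext a b α
  rw [dd_apply]
  exact sub_eq_zero.2 (f.naturality _).symm

theorem dd_fam_cc (f : T ⟶ U) (ψ : C0 U V) : dd T V (cc (fam f) ψ) = lc (fam f) (dd U V ψ) := by
  rw [dd_cc, dd_fam, zero_rc, zero_add]

theorem dd_cc_fam (φ : C0 T U) (g : U ⟶ V) : dd T V (cc φ (fam g)) = rc (dd T U φ) (fam g) := by
  rw [dd_cc, dd_fam, lc_zero, add_zero]

theorem gen_inv (f : U ⟶ V) : ∃ t : C0 V U, cc (cc (fam f) t) (fam f) = fam f := by
  have : ∀ a : Q, ∃ t : V.obj ((Paths.of Q).obj a) ⟶ U.obj ((Paths.of Q).obj a),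
      (fam f a ≫ t) ≫ fam f a = fam f a := by
    intro a
    obtain ⟨g, hg⟩ := LinearMap.exists_rightInverse_of_surjective (fam f a).hom.rangeRestrict
      (LinearMap.range_rangeRestrict _)
    obtain ⟨r, hr⟩ := LinearMap.exists_leftInverse_of_injective
      (LinearMap.range (fam f a).hom).subtype (Submodule.ker_subtype _)
    refine ⟨ModuleCat.ofHom (g ∘ₗ r), ?_⟩
    ext x
    have h1 : r ((fam f a).hom x) = (fam f a).hom.rangeRestrict x :=
      LinearMap.congr_fun hr ((fam f a).hom.rangeRestrict x)
    have h2 := congrArg Subtype.val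
      (LinearMap.congr_fun hg ((fam f a).hom.rangeRestrict x))
    simp only [ModuleCat.hom_comp, ModuleCat.hom_ofHom, LinearMap.comp_apply]
    rw [h1]
    exact h2
  choose t ht using this
  exact ⟨t, funext ht⟩

theorem mono_inv (f : U ⟶ V) [Mono f] : ∃ t : C0 V U, cc (fam f) t = one U := by
  obtain ⟨t, ht⟩ := gen_inv f
  refine ⟨t, funext fun a => ?_⟩
  have : Mono (fam f a) := inferInstanceAs (Mono (f.app _))
  rw [← cancel_mono (fam f a)]
  exact (congrFun ht a).trans (Category.id_comp _).symm

theorem epi_inv (f : U ⟶ V) [Epi f] : ∃ t : C0 V U, cc t (fam f) = one V := by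
  obtain ⟨t, ht⟩ := gen_inv f
  refine ⟨t, funext fun a => ?_⟩
  have : Epi (fam f a) := inferInstanceAs (Epi (f.app _))
  rw [← cancel_epi (fam f a)]
  exact (Category.assoc _ _ _).symm.trans ((congrFun ht a).trans (Category.comp_id _).symm)

theorem ses_inv (i : U ⟶ V) (p : V ⟶ W) (w : i ≫ p = 0)
    (h : (ShortComplex.mk i p w).ShortExact) :
    ∃ (s : C0 W V) (t : C0 V U), cc (fam i) t = one U ∧ cc s (fam p) = one W ∧
      cc (fam p) s + cc t (fam i) = one V := by
  have := h.mono_f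
  have := h.epi_g
  dsimp at *
  obtain ⟨s, hs⟩ := epi_inv p
  have : ∀ a : Q, ∃ t : V.obj ((Paths.of Q).obj a) ⟶ U.obj ((Paths.of Q).obj a),
      t ≫ fam i a = 𝟙 _ - fam p a ≫ s a := by
    intro a
    have ha := h.map_of_exact ((evaluation (Paths Q) (ModuleCat.{0} k)).obj ((Paths.of Q).obj a))
    have hsa : s a ≫ fam p a = 𝟙 _ := congrFun hs a
    have h0 : (𝟙 _ - fam p a ≫ s a) ≫ fam p a = 0 := by
      rw [Preadditive.sub_comp, Category.assoc, hsa, Category.id_comp, Category.comp_id, sub_self]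
    have := ha.mono_f
    exact ⟨ha.exact.lift _ h0, ha.exact.lift_f _ h0⟩
  choose t ht using this
  refine ⟨s, t, ?_, hs, ?_⟩
  · funext a
    have : Mono (fam i a) := inferInstanceAs (Mono (i.app _))
    rw [← cancel_mono (fam i a)]
    change (fam i a ≫ t a) ≫ fam i a = 𝟙 _ ≫ fam i a
    have hw : fam i a ≫ fam p a = 0 := congrFun (congrArg fam w) a
    rw [Category.assoc, ht, Preadditive.comp_sub, reassoc_of% hw]
    simp
  · funext a
    change fam p a ≫ s a + t a ≫ fam i a = 𝟙 _
    rw [ht]; abel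

theorem E0_mono {f : U ⟶ V} [Mono f] (h : E0 V W) : E0 U W := by
  intro c
  obtain ⟨t, ht⟩ := mono_inv f
  obtain ⟨φ, hφ⟩ := h (lc t c)
  exact ⟨cc (fam f) φ, by rw [dd_fam_cc, hφ, ← lc_assoc, ht, one_lc]⟩

theorem E0_epi {f : V ⟶ W} [Epi f] (h : E0 U V) : E0 U W := by
  intro c
  obtain ⟨t, ht⟩ := epi_inv f
  obtain ⟨φ, hφ⟩ := h (rc c t)
  exact ⟨cc φ (fam f), by rw [dd_cc_fam, hφ, rc_assoc, ht, rc_one]⟩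

theorem extend_along {A B C : Paths Q ⥤ ModuleCat.{0} k} (i : A ⟶ B) (p : B ⟶ C) (w : i ≫ p = 0)
    (h : (ShortComplex.mk i p w).ShortExact) (hE : E0 C W) (g : A ⟶ W) :
    ∃ g' : B ⟶ W, i ≫ g' = g := by
  obtain ⟨s, t, h1, h2, h3⟩ := ses_inv i p w h
  obtain ⟨φ, hφ⟩ := hE (lc s (dd B W (cc t (fam g))))
  have hw : cc (fam i) (fam p) = 0 := congrArg fam w
  have key : dd B W (cc t (fam g) - cc (fam p) φ) = 0 := by
    rw [map_sub, dd_fam_cc, hφ, ← lc_assoc, sub_eq_zero]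
    have e : cc (fam p) s = one B - cc t (fam i) := by rw [← h3]; abel
    rw [e, sub_lc, one_lc, lc_assoc, ← dd_fam_cc, ← cc_assoc, h1, one_cc, dd_fam, lc_zero,
      sub_zero]
  refine ⟨mkHom _ key, fam_ext ?_⟩
  rw [fam_comp, fam_mkHom, cc_sub, ← cc_assoc, ← cc_assoc, h1, hw, one_cc, zero_cc, sub_zero]

theorem lift_along {A B C : Paths Q ⥤ ModuleCat.{0} k} (i : A ⟶ B) (p : B ⟶ C) (w : i ≫ p = 0)
    (h : (ShortComplex.mk i p w).ShortExact) (hE : E0 W A) (g : W ⟶ C) :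
    ∃ g' : W ⟶ B, g' ≫ p = g := by
  obtain ⟨s, t, h1, h2, h3⟩ := ses_inv i p w h
  obtain ⟨φ, hφ⟩ := hE (rc (dd W B (cc (fam g) s)) t)
  have hw : cc (fam i) (fam p) = 0 := congrArg fam w
  have key : dd W B (cc (fam g) s - cc φ (fam i)) = 0 := by
    rw [map_sub, dd_cc_fam, hφ, rc_assoc, sub_eq_zero]
    have e : cc t (fam i) = one B - cc (fam p) s := by rw [← h3]; abel
    rw [e, rc_sub, rc_one, ← rc_assoc, ← dd_cc_fam, cc_assoc, h2, cc_one, dd_fam, zero_rc,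
      sub_zero]
  refine ⟨mkHom _ key, fam_ext ?_⟩
  rw [fam_comp, fam_mkHom, sub_cc, cc_assoc, cc_assoc, h2, hw, cc_one, cc_zero, sub_zero]

theorem E0_mid_right {A B C : Paths Q ⥤ ModuleCat.{0} k} (i : A ⟶ B) (p : B ⟶ C)
    (w : i ≫ p = 0) (h : (ShortComplex.mk i p w).ShortExact) (hC : E0 W C)
    (hA : ∀ c : C1 W A, ∃ φ, dd W B φ = rc c (fam i)) : E0 W B := by
  intro c
  obtain ⟨s, t, h1, h2, h3⟩ := ses_inv i p w h
  obtain ⟨φ, hφ⟩ := hC (rc c (fam p))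
  obtain ⟨ψ, hψ⟩ := hA (rc (c - dd W B (cc φ s)) t)
  refine ⟨cc φ s + ψ, ?_⟩
  have e : cc t (fam i) = one B - cc (fam p) s := by rw [← h3]; abel
  rw [map_add, hψ, rc_assoc, e, rc_sub, rc_one, ← rc_assoc, sub_rc, ← dd_cc_fam, cc_assoc, h2,
    cc_one, hφ, sub_self, zero_rc]
  abel

theorem E0_mid_left {A B C : Paths Q ⥤ ModuleCat.{0} k} (i : A ⟶ B) (p : B ⟶ C)
    (w : i ≫ p = 0) (h : (ShortComplex.mk i p w).ShortExact) (hA : E0 A W)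
    (hC : ∀ c : C1 C W, ∃ φ, dd B W φ = lc (fam p) c) : E0 B W := by
  intro c
  obtain ⟨s, t, h1, h2, h3⟩ := ses_inv i p w h
  obtain ⟨φ, hφ⟩ := hA (lc (fam i) c)
  obtain ⟨ψ, hψ⟩ := hC (lc s (c - dd B W (cc t φ)))
  refine ⟨cc t φ + ψ, ?_⟩
  have e : cc (fam p) s = one B - cc t (fam i) := by rw [← h3]; abel
  rw [map_add, hψ, ← lc_assoc, e, sub_lc, one_lc, lc_assoc, lc_sub, ← dd_fam_cc, ← cc_assoc, h1,
    one_cc, hφ, sub_self, lc_zero]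
  abel

theorem ext1Zero_of_E0 (h : E0 V W) : Ext1Zero V W := by
  intro E ι p w hS
  exact extend_along ι p w hS h (𝟙 W)

end part1

section part2

variable {k : Type} [Field k] {Q : Type} [Quiver.{1} Q]
variable {T U V W : Paths Q ⥤ ModuleCat.{0} k}

theorem mono_of_inv (f : U ⟶ V) (t : C0 V U) (h : cc (fam f) t = one U) : Mono f := by
  constructor
  intro Z g g' hg
  apply fam_ext
  have := congrArg (fun x => cc (fam x) t) hg
  simpa only [fam_comp, cc_assoc, h, cc_one] using this

theorem epi_of_inv (f : U ⟶ V) (t : C0 V U) (h : cc t (fam f) = one V) : Epi f := by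
  constructor
  intro Z g g' hg
  apply fam_ext
  have := congrArg (fun x => cc t (fam x)) hg
  simpa only [fam_comp, ← cc_assoc, h, one_cc] using this

theorem ses_mk (i : U ⟶ V) (p : V ⟶ W) (w : i ≫ p = 0) (s : C0 W V) (t : C0 V U)
    (h1 : cc (fam i) t = one U) (h2 : cc s (fam p) = one W)
    (h3 : cc (fam p) s + cc t (fam i) = one V) : (ShortComplex.mk i p w).ShortExact := by
  have : Mono i := mono_of_inv i t h1
  have h' : Epi p := epi_of_inv p s h2
  refine { exact := ?_, mono_f := this, epi_g := h' }
  apply ShortComplex.exact_of_f_is_kernel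
  refine KernelFork.IsLimit.ofι' i w (fun {A} x hx => ?_)
  have hx' : cc (fam x) (fam p) = 0 := congrArg fam hx
  have e : cc (cc (fam x) t) (fam i) = fam x := by
    have := congrArg (cc (fam x)) h3
    rw [cc_add, ← cc_assoc, hx', zero_cc, zero_add, cc_one, ← cc_assoc] at this
    exact this
  have hd : dd A U (cc (fam x) t) = 0 := by
    have h4 : rc (dd A U (cc (fam x) t)) (fam i) = 0 := by
      rw [← dd_cc_fam, e, dd_fam]
    have := congrArg (fun y => rc y t) h4
    simpa only [rc_assoc, h1, rc_one, zero_rc] using this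
  exact ⟨mkHom _ hd, fam_ext e⟩

theorem bip_aux1 {A B A' B' : ModuleCat.{0} k} (u : A ⟶ A') (v : B ⟶ B') (c : B ⟶ A') :
    (biprod.snd : A ⊞ B ⟶ B) ≫ v =
      biprod.desc (u ≫ biprod.inl) (c ≫ biprod.inl + v ≫ biprod.inr) ≫ biprod.snd := by
  apply biprod.hom_ext' <;> simp

theorem bip_aux2 {A B A' B' : ModuleCat.{0} k} (u : A ⟶ A') (v : B ⟶ B') (c : B ⟶ A') :
    (biprod.fst : A ⊞ B ⟶ A) ≫ u = -(biprod.snd ≫ c) +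
      biprod.desc (u ≫ biprod.inl) (c ≫ biprod.inl + v ≫ biprod.inr) ≫ biprod.fst := by
  apply biprod.hom_ext' <;> simp

/-- the prefunctor underlying the extension by a cocycle -/
noncomputable def extPre (c : C1 V W) : Q ⥤q ModuleCat.{0} k where
  obj a := W.obj ((Paths.of Q).obj a) ⊞ V.obj ((Paths.of Q).obj a)
  map {a b} α := biprod.desc (W.map ((Paths.of Q).map α) ≫ biprod.inl)
    (c a b α ≫ biprod.inl + V.map ((Paths.of Q).map α) ≫ biprod.inr)

theorem exists_ext (c : C1 V W) :
    ∃ (E : Paths Q ⥤ ModuleCat.{0} k) (i : W ⟶ E) (p : E ⟶ V) (w : i ≫ p = 0)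
      (s : C0 V E) (r : C0 E W), (ShortComplex.mk i p w).ShortExact ∧
      dd V E s = rc c (fam i) ∧ dd E W r = - lc (fam p) c := by
  let E := Paths.lift (extPre c)
  have hE : ∀ (a b : Q) (α : a ⟶ b), E.map ((Paths.of Q).map α) =
    biprod.desc (W.map ((Paths.of Q).map α) ≫ biprod.inl)
    (c a b α ≫ biprod.inl + V.map ((Paths.of Q).map α) ≫ biprod.inr) :=
    fun a b α => Paths.lift_toPath (extPre c) α
  let i0 : C0 W E := fun a => (biprod.inl : W.obj ((Paths.of Q).obj a) ⟶
    W.obj ((Paths.of Q).obj a) ⊞ V.obj ((Paths.of Q).obj a))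
  let s : C0 V E := fun a => (biprod.inr : V.obj ((Paths.of Q).obj a) ⟶
    W.obj ((Paths.of Q).obj a) ⊞ V.obj ((Paths.of Q).obj a))
  let p0 : C0 E V := fun a => (biprod.snd : W.obj ((Paths.of Q).obj a) ⊞
    V.obj ((Paths.of Q).obj a) ⟶ V.obj ((Paths.of Q).obj a))
  let r : C0 E W := fun a => (biprod.fst : W.obj ((Paths.of Q).obj a) ⊞
    V.obj ((Paths.of Q).obj a) ⟶ W.obj ((Paths.of Q).obj a))
  have hi : dd W E i0 = 0 := by
    funext a b α
    rw [dd_apply, hE]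
    exact sub_eq_zero.2 (biprod.inl_desc _ _)
  have hp : dd E V p0 = 0 := by
    funext a b α
    rw [dd_apply, hE]
    exact sub_eq_zero.2 (bip_aux1 _ _ _)
  have w : mkHom i0 hi ≫ mkHom p0 hp = 0 := by
    apply fam_ext
    funext a
    exact biprod.inl_snd
  refine ⟨E, mkHom i0 hi, mkHom p0 hp, w, s, r, ses_mk _ _ w s r ?_ ?_ ?_, ?_, ?_⟩
  · funext a; exact biprod.inl_fst
  · funext a; exact biprod.inr_snd
  · funext a; exact (add_comm _ _).trans biprod.total
  · funext a b α
    rw [dd_apply, hE]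
    refine sub_eq_iff_eq_add.2 ?_
    exact biprod.inr_desc _ _
  · funext a b α
    rw [dd_apply, hE]
    exact sub_eq_iff_eq_add.2 (bip_aux2 _ _ _)

theorem E0_of_ext1Zero (h : Ext1Zero V W) : E0 V W := by
  intro c
  obtain ⟨E, i, p, w, s, r, hS, hs, -⟩ := exists_ext c
  obtain ⟨r0, hr0⟩ := h E i p w hS
  refine ⟨cc s (fam r0), ?_⟩
  rw [dd_cc_fam, hs, rc_assoc, ← fam_comp, hr0, fam_id, rc_one]

/-- endomorphism ring is `k` -/
def EndK (V : Paths Q ⥤ ModuleCat.{0} k) : Prop := ∀ f : V ⟶ V, ∃ c : k, f = c • 𝟙 V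

/-- Happel-Ringel -/
theorem happel_ringel (hU : EndK U) (hV : EndK V) (hE : E0 V U) (f : U ⟶ V) (hf : f ≠ 0) :
    Mono f ∨ Epi f := by
  obtain ⟨t, ht⟩ := gen_inv f
  set n : C0 V V := one V - cc t (fam f) with hn
  have fn : cc (fam f) n = 0 := by rw [hn, cc_sub, cc_one, ← cc_assoc, ht, sub_self]
  have nn : cc n n = n := by
    conv_lhs => enter [1]; rw [hn]
    rw [sub_cc, one_cc, cc_assoc, fn, cc_zero, sub_zero]
  have done : dd V V (one V) = 0 := dd_fam (𝟙 V)
  have dn : dd V V n = - rc (dd V U t) (fam f) := by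
    rw [hn, map_sub, done, dd_cc_fam, zero_sub]
  have A : rc (rc (dd V V n) t) (fam f) = dd V V n := by
    have h1 : rc (dd V V n) n = 0 := by
      have : rc (dd V V n) n = rc (0 - rc (dd V U t) (fam f)) n := by rw [dn, zero_sub]
      rw [this, sub_rc, zero_rc, rc_assoc, fn, rc_zero, sub_zero]
    have h2 : cc t (fam f) = one V - n := by rw [hn]; abel
    rw [rc_assoc, h2, rc_sub, rc_one, h1, sub_zero]
  have B : lc (fam f) (dd V V n) = 0 := by rw [← dd_fam_cc, fn, map_zero]
  obtain ⟨φ, hφ⟩ := hE (rc (dd V V n) t)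
  have hθ : dd V V (n - cc φ (fam f)) = 0 := by
    rw [map_sub, dd_cc_fam, hφ, A, sub_self]
  obtain ⟨l, hl⟩ := hV (mkHom _ hθ)
  have hl' : n - cc φ (fam f) = l • one V := by
    have := congrArg fam hl
    rwa [fam_mkHom, fam_smul, fam_id] at this
  have hln : n = l • n := by
    have := congrArg (fun x => cc x n) hl'
    simpa only [sub_cc, nn, cc_assoc, fn, cc_zero, sub_zero, smul_cc, one_cc] using this
  by_cases h1 : l = 1
  · left
    have hψ : dd U U (cc (fam f) φ) = 0 := by
      rw [dd_fam_cc, hφ, ← lrc_assoc, B, zero_rc]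
    obtain ⟨m, hm⟩ := hU (mkHom _ hψ)
    have hm' : cc (fam f) φ = m • one U := by
      have := congrArg fam hm
      rwa [fam_mkHom, fam_smul, fam_id] at this
    have e1 : - (m • fam f) = fam f := by
      have := congrArg (cc (fam f)) hl'
      rw [cc_sub, fn, ← cc_assoc, hm', smul_cc, one_cc, h1, one_smul, cc_one, zero_sub] at this
      exact this
    have e2 : (m + 1) • fam f = 0 := by
      rw [add_smul, one_smul]
      nth_rewrite 2 [← e1]
      abel
    have hm1 : m = -1 := by
      rcases smul_eq_zero.1 e2 with h | h
      · exact eq_neg_of_add_eq_zero_left h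
      · exact absurd (fam_ext (h.trans fam_zero.symm)) hf
    refine mono_of_inv f ((-1 : k) • φ) ?_
    rw [cc_smul, hm', hm1, smul_smul]
    simp
  · right
    have hn0 : n = 0 := by
      have : (1 - l) • n = 0 := by rw [sub_smul, one_smul, ← hln, sub_self]
      rcases smul_eq_zero.1 this with h | h
      · exact absurd (sub_eq_zero.1 h).symm h1
      · exact h
    exact epi_of_inv f t (sub_eq_zero.1 (hn.symm.trans hn0)).symm

end part2

section part3

variable {k : Type} [Field k] {Q : Type} [Quiver.{1} Q]
variable {T U V W : Paths Q ⥤ ModuleCat.{0} k}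

/-- finite-dimensional representation -/
def FD (V : Paths Q ⥤ ModuleCat.{0} k) : Prop := ∀ q : Paths Q, FiniteDimensional k (V.obj q)

theorem app_inj (f : U ⟶ V) [Mono f] (q : Paths Q) : Function.Injective (f.app q).hom :=
  (ModuleCat.mono_iff_injective (f.app q)).1 inferInstance

theorem app_surj (f : U ⟶ V) [Epi f] (q : Paths Q) : Function.Surjective (f.app q).hom :=
  (ModuleCat.epi_iff_surjective (f.app q)).1 inferInstance

theorem FD_mono (f : U ⟶ V) [Mono f] (h : FD V) : FD U := fun q => by
  have := h q
  exact FiniteDimensional.of_injective (f.app q).hom (app_inj f q)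

theorem FD_epi (f : U ⟶ V) [Epi f] (h : FD U) : FD V := fun q => by
  have := h q
  exact Module.Finite.of_surjective (f.app q).hom (app_surj f q)

theorem FD_mid (i : U ⟶ V) (p : V ⟶ W) (w : i ≫ p = 0)
    (h : (ShortComplex.mk i p w).ShortExact) (hU : FD U) (hW : FD W) : FD V := by
  obtain ⟨s, t, h1, h2, h3⟩ := ses_inv i p w h
  have main : ∀ q : Q, FiniteDimensional k (V.obj ((Paths.of Q).obj q)) := by
    intro q
    have : FiniteDimensional k (U.obj ((Paths.of Q).obj q)) := hU _
    have : FiniteDimensional k (W.obj ((Paths.of Q).obj q)) := hW _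
    refine FiniteDimensional.of_injective ((fam p q).hom.prod (t q).hom) ?_
    rw [← LinearMap.ker_eq_bot, LinearMap.ker_eq_bot']
    intro x hx
    have hx1 : (fam p q).hom x = 0 := congrArg Prod.fst hx
    have hx2 : (t q).hom x = 0 := congrArg Prod.snd hx
    have := congrArg (fun y => ModuleCat.Hom.hom (y q) x) h3
    change (s q).hom ((fam p q).hom x) + (fam i q).hom ((t q).hom x) = x at this
    rw [hx1, hx2, map_zero, map_zero, add_zero] at this
    exact this.symm
  exact fun q => main q

/-- `fam` as a linear map -/
def famL (V W : Paths Q ⥤ ModuleCat.{0} k) : (V ⟶ W) →ₗ[k] C0 V W where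
  toFun := fam
  map_add' _ _ := rfl
  map_smul' _ _ := rfl

theorem famL_inj : Function.Injective (famL V W) := fun _ _ h => fam_ext h

theorem famL_range : LinearMap.range (famL V W) = LinearMap.ker (dd V W) := by
  ext φ
  constructor
  · rintro ⟨f, rfl⟩
    exact dd_fam f
  · intro h
    exact ⟨mkHom φ h, rfl⟩

theorem fd_hom (hV : FD V) (hW : FD W) (a b : Paths Q) : FiniteDimensional k (V.obj a ⟶ W.obj b) := by
  have := hV a
  have := hW b
  exact Module.Finite.equiv (ModuleCat.homLinearEquiv (S := k) (M := V.obj a) (N := W.obj b)).symm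

theorem finrank_hom (hV : FD V) (hW : FD W) (a b : Paths Q) :
    Module.finrank k (V.obj a ⟶ W.obj b) =
      Module.finrank k (V.obj a) * Module.finrank k (W.obj b) := by
  have := hV a
  have := hW b
  rw [(ModuleCat.homLinearEquiv (S := k) (M := V.obj a) (N := W.obj b)).finrank_eq]
  exact Module.finrank_linearMap k k (V.obj a) (W.obj b)

theorem isZero_of_dim (hV : FD V)
    (h0 : ∀ a : Q, Module.finrank k (V.obj ((Paths.of Q).obj a)) = 0) : IsZero V := by
  rw [IsZero.iff_id_eq_zero]
  apply fam_ext
  funext a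
  have := hV ((Paths.of Q).obj a)
  have := Module.finrank_zero_iff.1 (h0 a)
  ext x
  exact Subsingleton.elim _ _

/-- dimension vector -/
noncomputable def dimv (V : Paths Q ⥤ ModuleCat.{0} k) : Q → ℚ :=
  fun a => (Module.finrank k (V.obj ((Paths.of Q).obj a)) : ℚ)

theorem dimv_ne_zero (hV : FD V) (h : ¬ IsZero V) : dimv V ≠ 0 := by
  intro h0
  refine h (isZero_of_dim hV fun a => ?_)
  have := congrFun h0 a
  simpa [dimv] using this

variable [Fintype Q]

theorem fd_C0 (hV : FD V) (hW : FD W) : FiniteDimensional k (C0 V W) := by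
  have := fun a : Q => fd_hom hV hW ((Paths.of Q).obj a) ((Paths.of Q).obj a)
  exact Module.Finite.pi

theorem fd_Hom (hV : FD V) (hW : FD W) : FiniteDimensional k (V ⟶ W) := by
  have := fd_C0 hV hW
  exact FiniteDimensional.of_injective (famL V W) famL_inj

/-- total dimension -/
noncomputable def tot (V : Paths Q ⥤ ModuleCat.{0} k) : ℕ :=
  ∑ a : Q, Module.finrank k (V.obj ((Paths.of Q).obj a))

theorem tot_mono (f : U ⟶ V) [Mono f] (h : FD V) : tot U ≤ tot V := by
  refine Finset.sum_le_sum fun a _ => ?_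
  have := h ((Paths.of Q).obj a)
  exact LinearMap.finrank_le_finrank_of_injective (app_inj f _)

theorem tot_epi (f : U ⟶ V) [Epi f] (h : FD U) : tot V ≤ tot U := by
  refine Finset.sum_le_sum fun a _ => ?_
  have := h ((Paths.of Q).obj a)
  exact LinearMap.finrank_le_finrank_of_surjective (app_surj f _)

theorem iso_of_mono (f : U ⟶ V) [Mono f] (h : FD V) (ht : tot V ≤ tot U) : IsIso f := by
  have he := (Finset.sum_eq_sum_iff_of_le (s := Finset.univ)
    (f := fun a : Q => Module.finrank k (U.obj ((Paths.of Q).obj a)))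
    (g := fun a : Q => Module.finrank k (V.obj ((Paths.of Q).obj a))) (fun a _ => by
      have := h ((Paths.of Q).obj a)
      exact LinearMap.finrank_le_finrank_of_injective (app_inj f _))).1
      (le_antisymm (tot_mono f h) ht)
  have : Epi f := by
    have : ∀ q : Paths Q, Epi (f.app q) := by
      intro q
      rw [ModuleCat.epi_iff_surjective]
      have := h q
      have := FD_mono f h q
      exact (LinearMap.injective_iff_surjective_of_finrank_eq_finrank
        (show Module.finrank k (U.obj q) = Module.finrank k (V.obj q) from
          he q (Finset.mem_univ _))).1 (app_inj f q)
    exact NatTrans.epi_of_epi_app f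
  exact isIso_of_mono_of_epi f

theorem iso_of_epi (f : U ⟶ V) [Epi f] (h : FD U) (ht : tot U ≤ tot V) : IsIso f := by
  have he := (Finset.sum_eq_sum_iff_of_le (s := Finset.univ)
    (f := fun a : Q => Module.finrank k (V.obj ((Paths.of Q).obj a)))
    (g := fun a : Q => Module.finrank k (U.obj ((Paths.of Q).obj a))) (fun a _ => by
      have := h ((Paths.of Q).obj a)
      exact LinearMap.finrank_le_finrank_of_surjective (app_surj f _))).1
      (le_antisymm (tot_epi f h) ht)
  have : Mono f := by
    have : ∀ q : Paths Q, Mono (f.app q) := by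
      intro q
      rw [ModuleCat.mono_iff_injective]
      have := h q
      have := FD_epi f h q
      exact (LinearMap.injective_iff_surjective_of_finrank_eq_finrank
        (show Module.finrank k (U.obj q) = Module.finrank k (V.obj q) from
          (he q (Finset.mem_univ _)).symm)).2 (app_surj f q)
    exact NatTrans.mono_of_mono_app f
  exact isIso_of_mono_of_epi f

variable [∀ a b : Q, Fintype (a ⟶ b)]

/-- Euler form -/
def Eu (x y : Q → ℚ) : ℚ := (∑ a : Q, x a * y a) -
        ∑ a : Q, ∑ b : Q, (Fintype.card (a ⟶ b) : ℚ) * (x a * y b)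

theorem Eu_sub (x y : Q → ℚ) : Eu (x - y) (x - y) = Eu x x + Eu y y - Eu x y - Eu y x := by
  simp only [Eu, Pi.sub_apply, sub_mul, mul_sub, Finset.sum_sub_distrib]
  ring

theorem fd_C1 (hV : FD V) (hW : FD W) : FiniteDimensional k (C1 V W) := by
  have := fun a b : Q => fd_hom hV hW ((Paths.of Q).obj a) ((Paths.of Q).obj b)
  infer_instance

theorem Eu_eq (hV : FD V) (hW : FD W) : Eu (dimv V) (dimv W) =
    (Module.finrank k (C0 V W) : ℚ) - Module.finrank k (C1 V W) := by
  have h1 := fun a b : Q => fd_hom hV hW ((Paths.of Q).obj a) ((Paths.of Q).obj b)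
  rw [Eu]
  congr 1
  · rw [Module.finrank_pi_fintype]
    push_cast
    refine Finset.sum_congr rfl fun a _ => ?_
    rw [finrank_hom hV hW]
    push_cast
    rfl
  · rw [Module.finrank_pi_fintype]
    push_cast
    refine Finset.sum_congr rfl fun a _ => ?_
    rw [Module.finrank_pi_fintype]
    push_cast
    refine Finset.sum_congr rfl fun b _ => ?_
    rw [Module.finrank_pi_fintype]
    rw [finrank_hom hV hW]
    simp [dimv]

theorem finrank_Hom (hV : FD V) (hW : FD W) :
    (Module.finrank k (V ⟶ W) : ℚ) = Eu (dimv V) (dimv W) +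
      (Module.finrank k (C1 V W) - Module.finrank k (LinearMap.range (dd V W))) := by
  have := fd_C0 hV hW
  have h1 := LinearMap.finrank_range_add_finrank_ker (dd V W)
  have h2 := LinearMap.finrank_range_of_inj (famL_inj (V := V) (W := W))
  rw [famL_range] at h2
  rw [Eu_eq hV hW, ← h1, ← h2]
  push_cast
  ring

theorem Eu_le (hV : FD V) (hW : FD W) : Eu (dimv V) (dimv W) ≤ Module.finrank k (V ⟶ W) := by
  have := fd_C1 hV hW
  rw [finrank_Hom hV hW]
  have : (Module.finrank k (LinearMap.range (dd V W)) : ℚ) ≤ Module.finrank k (C1 V W) := by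
    exact_mod_cast Submodule.finrank_le _
  linarith

theorem Eu_of_E0 (hV : FD V) (hW : FD W) (h : E0 V W) :
    Eu (dimv V) (dimv W) = Module.finrank k (V ⟶ W) := by
  rw [finrank_Hom hV hW, LinearMap.range_eq_top.2 h, finrank_top]
  ring

theorem E0_of_Eu (hV : FD V) (hW : FD W) (h : (Module.finrank k (V ⟶ W) : ℚ) ≤ 1)
    (h' : 0 < Eu (dimv V) (dimv W)) : E0 V W := by
  have := fd_C1 hV hW
  refine LinearMap.range_eq_top.1 (Submodule.eq_top_of_finrank_eq ?_)
  rw [finrank_Hom hV hW] at h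
  have h2 := Submodule.finrank_le (LinearMap.range (dd V W))
  by_contra hne
  have h3 : Module.finrank k (LinearMap.range (dd V W)) + 1 ≤ Module.finrank k (C1 V W) := by
    omega
  have h4 : (Module.finrank k (LinearMap.range (dd V W)) : ℚ) + 1 ≤ Module.finrank k (C1 V W) := by
    exact_mod_cast h3
  linarith

theorem hom_le_one
    (hdynkin : ∀ x : Q → ℚ, x ≠ 0 → 0 < Eu x x)
    (hU : FD U) (hV : FD V) (hU1 : Module.finrank k (U ⟶ U) = 1)
    (hV1 : Module.finrank k (V ⟶ V) = 1)
    (hUU : E0 U U) (hVV : E0 V V) (hUV : E0 U V) (hVU : E0 V U) :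
    Module.finrank k (U ⟶ V) ≤ 1 := by
  have e1 := Eu_of_E0 hU hU hUU
  have e2 := Eu_of_E0 hV hV hVV
  have e3 := Eu_of_E0 hU hV hUV
  have e4 := Eu_of_E0 hV hU hVU
  rw [hU1] at e1
  rw [hV1] at e2
  by_cases h : dimv U = dimv V
  · rw [← h, e1] at e3
    have : (1 : ℕ) = Module.finrank k (U ⟶ V) := by exact_mod_cast e3
    omega
  · have := hdynkin (dimv U - dimv V) (sub_ne_zero.2 h)
    rw [Eu_sub, e1, e2, e3, e4] at this
    have h5 : Module.finrank k (U ⟶ V) + Module.finrank k (V ⟶ U) < 2 := by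
      have : (Module.finrank k (U ⟶ V) : ℚ) + Module.finrank k (V ⟶ U) < 2 := by
        push_cast at this; linarith
      exact_mod_cast this
    omega

end part3

section part4

variable {k : Type} [Field k] {Q : Type} [Quiver.{1} Q]
variable {T U V W : Paths Q ⥤ ModuleCat.{0} k}

theorem retract_iso {I : Paths Q ⥤ ModuleCat.{0} k} (hV : Indec V) (m : I ⟶ V) (e : V ⟶ I)
    (h : m ≫ e = 𝟙 I) (hI : ¬ IsZero I) : IsIso m := by
  have hm : IsSplitMono m := ⟨⟨⟨e, h⟩⟩⟩
  have hb := isBilimitBinaryBiconeOfIsSplitMonoOfCokernel (cokernelIsCokernel m)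
  have hiso : V ≅ I ⊞ cokernel m := biprod.uniqueUpToIso _ _ hb
  have hz : IsZero (cokernel m) := (hV.2 _ _ ⟨hiso⟩).resolve_left hI
  have : Epi m := Preadditive.epi_of_cokernel_zero (hz.eq_of_tgt _ _)
  exact isIso_of_mono_of_epi m

/-- decomposition into indecomposables -/
def HasDec (X : Paths Q ⥤ ModuleCat.{0} k) : Prop :=
  ∃ (J : Type) (_ : Fintype J) (f : J → (Paths Q ⥤ ModuleCat.{0} k)) (i : ∀ j, f j ⟶ X)
    (π : ∀ j, X ⟶ f j), (∀ j, Indec (f j)) ∧ (∀ j, i j ≫ π j = 𝟙 _) ∧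
    (∀ j l, j ≠ l → i j ≫ π l = 0) ∧ ∑ j, π j ≫ i j = 𝟙 X

theorem hasDec_biprod {X A B : Paths Q ⥤ ModuleCat.{0} k} (φ : X ≅ A ⊞ B) (hA : HasDec A)
    (hB : HasDec B) : HasDec X := by
  obtain ⟨J, _, f, i, π, h1, h2, h3, h4⟩ := hA
  obtain ⟨J', _, f', i', π', h1', h2', h3', h4'⟩ := hB
  refine ⟨J ⊕ J', inferInstance, Sum.elim f f',
    fun j => match j with
      | Sum.inl j => i j ≫ biprod.inl ≫ φ.inv
      | Sum.inr j => i' j ≫ biprod.inr ≫ φ.inv,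
    fun j => match j with
      | Sum.inl j => φ.hom ≫ biprod.fst ≫ π j
      | Sum.inr j => φ.hom ≫ biprod.snd ≫ π' j, ?_, ?_, ?_, ?_⟩
  · rintro (j | j)
    · exact h1 j
    · exact h1' j
  · rintro (j | j)
    · simpa using h2 j
    · simpa using h2' j
  · rintro (j | j) (l | l) hjl
    · have e : (i j ≫ biprod.inl ≫ φ.inv) ≫ φ.hom ≫ biprod.fst ≫ π l = 0 := by
        simp [h3 j l (fun h => hjl (by rw [h]))]
      exact e
    · have e : (i j ≫ biprod.inl ≫ φ.inv) ≫ φ.hom ≫ biprod.snd ≫ π' l = 0 := by simp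
      exact e
    · have e : (i' j ≫ biprod.inr ≫ φ.inv) ≫ φ.hom ≫ biprod.fst ≫ π l = 0 := by simp
      exact e
    · have e : (i' j ≫ biprod.inr ≫ φ.inv) ≫ φ.hom ≫ biprod.snd ≫ π' l = 0 := by
        simp [h3' j l (fun h => hjl (by rw [h]))]
      exact e
  · rw [Fintype.sum_sum_type]
    have e1 : ∑ j, (φ.hom ≫ biprod.fst ≫ π j) ≫ i j ≫ biprod.inl ≫ φ.inv =
        φ.hom ≫ (biprod.fst ≫ biprod.inl) ≫ φ.inv := by
      have := congrArg (fun y => φ.hom ≫ biprod.fst ≫ y ≫ biprod.inl ≫ φ.inv) h4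
      simpa [Preadditive.sum_comp, Preadditive.comp_sum] using this
    have e2 : ∑ j, (φ.hom ≫ biprod.snd ≫ π' j) ≫ i' j ≫ biprod.inr ≫ φ.inv =
        φ.hom ≫ (biprod.snd ≫ biprod.inr) ≫ φ.inv := by
      have := congrArg (fun y => φ.hom ≫ biprod.snd ≫ y ≫ biprod.inr ≫ φ.inv) h4'
      simpa [Preadditive.sum_comp, Preadditive.comp_sum] using this
    refine (congrArg₂ (· + ·) e1 e2).trans ?_
    rw [← Preadditive.comp_add, ← Preadditive.add_comp, biprod.total]
    simp

variable [Fintype Q]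

theorem hasDec (n : ℕ) : ∀ X : Paths Q ⥤ ModuleCat.{0} k, FD X → tot X = n → HasDec X := by
  induction n using Nat.strong_induction_on with
  | _ n ih =>
  intro X hX hn
  by_cases hz : IsZero X
  · exact ⟨Empty, inferInstance, fun j => j.elim, fun j => j.elim, fun j => j.elim,
      fun j => j.elim, fun j => j.elim, fun j => j.elim, hz.eq_of_src _ _⟩
  by_cases hi : Indec X
  · refine ⟨Unit, inferInstance, fun _ => X, fun _ => 𝟙 X, fun _ => 𝟙 X, fun _ => hi,
      fun _ => by simp, fun j l h => absurd (Subsingleton.elim j l) h, by simp⟩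
  · have : ∃ A B : Paths Q ⥤ ModuleCat.{0} k, Nonempty (X ≅ A ⊞ B) ∧ ¬ IsZero A ∧ ¬ IsZero B := by
      by_contra hcon
      refine hi ⟨hz, fun A B hAB => ?_⟩
      by_contra h
      rw [not_or] at h
      exact hcon ⟨A, B, hAB, h⟩
    obtain ⟨A, B, ⟨φ⟩, hA, hB⟩ := this
    refine hasDec_biprod φ (ih (tot A) ?_ A (FD_mono (biprod.inl ≫ φ.inv) hX) rfl)
      (ih (tot B) ?_ B (FD_mono (biprod.inr ≫ φ.inv) hX) rfl)
    · by_contra hlt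
      have := iso_of_mono (biprod.inl ≫ φ.inv) hX (by omega)
      have h2 : (biprod.inl ≫ φ.inv) ≫ φ.hom ≫ (biprod.snd : A ⊞ B ⟶ B) = 0 := by simp
      rw [Preadditive.IsIso.comp_left_eq_zero, Preadditive.IsIso.comp_left_eq_zero] at h2
      apply hB
      rw [IsZero.iff_id_eq_zero, ← biprod.inr_snd (X := A) (Y := B), h2, comp_zero]
    · by_contra hlt
      have := iso_of_mono (biprod.inr ≫ φ.inv) hX (by omega)
      have h2 : (biprod.inr ≫ φ.inv) ≫ φ.hom ≫ (biprod.fst : A ⊞ B ⟶ A) = 0 := by simp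
      rw [Preadditive.IsIso.comp_left_eq_zero, Preadditive.IsIso.comp_left_eq_zero] at h2
      apply hA
      rw [IsZero.iff_id_eq_zero, ← biprod.inl_fst (X := A) (Y := B), h2, comp_zero]

/-- every nonzero endomorphism is invertible -/
def Brick (V : Paths Q ⥤ ModuleCat.{0} k) : Prop := ∀ θ : V ⟶ V, θ = 0 ∨ IsIso θ

theorem finrank_of_brick [IsAlgClosed k] (hV : FD V) (hz : ¬ IsZero V) (h : Brick V) :
    Module.finrank k (V ⟶ V) = 1 := by
  have := fd_Hom hV hV
  refine finrank_endomorphism_eq_one k fun f => ⟨fun hf h0 => hz ?_, fun h0 => (h f).resolve_left h0⟩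
  subst h0
  rw [IsZero.iff_id_eq_zero, ← IsIso.hom_inv_id (0 : V ⟶ V), zero_comp]

theorem endK_of_finrank (hz : ¬ IsZero V) (h : Module.finrank k (V ⟶ V) = 1) : EndK V := by
  intro f
  have h0 : 𝟙 V ≠ 0 := fun h0 => hz ((IsZero.iff_id_eq_zero V).2 h0)
  obtain ⟨c, hc⟩ := (finrank_eq_one_iff_of_nonzero' (𝟙 V) h0).1 h f
  exact ⟨c, hc.symm⟩

theorem tot_image_le (hV : FD V) {θ : V ⟶ V} {Z : Paths Q ⥤ ModuleCat.{0} k} (x : V ⟶ Z)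
    (y : Z ⟶ V) [Mono y] (h : x ≫ y = θ) : tot (image θ) ≤ tot Z := by
  let F : MonoFactorisation θ := { I := Z, m := y, e := x, fac := h }
  have : Mono (image.lift F) := inferInstance
  exact tot_mono (image.lift F) (FD_mono y hV)

variable [∀ a b : Q, Fintype (a ⟶ b)]

theorem brick_of_indec [IsAlgClosed k] (hdynkin : ∀ x : Q → ℚ, x ≠ 0 → 0 < Eu x x) (n : ℕ) :
    ∀ V : Paths Q ⥤ ModuleCat.{0} k, FD V → Indec V → tot V = n → Brick V := by
  induction n using Nat.strong_induction_on with
  | _ n ih =>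
  intro V hV hI hn
  by_contra hcon
  let P : (V ⟶ V) → Prop := fun θ => θ ≠ 0 ∧ ¬ IsIso θ
  have hP : ∃ θ, P θ := by
    by_contra h
    refine hcon fun θ => ?_
    by_contra h'
    rw [not_or] at h'
    exact h ⟨θ, h'⟩
  obtain ⟨θ, hθ, hmin⟩ : ∃ θ, P θ ∧ ∀ θ', P θ' → tot (image θ) ≤ tot (image θ') := by
    obtain ⟨θ, h1, h2⟩ := (measure fun θ : V ⟶ V => tot (image θ)).wf.has_min {θ | P θ} hP
    exact ⟨θ, h1, fun θ' h' => not_lt.1 (h2 θ' h')⟩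
  obtain ⟨I, e, m, he, hm, hem, hIdim⟩ : ∃ (I : Paths Q ⥤ ModuleCat.{0} k) (e : V ⟶ I) (m : I ⟶ V),
      Epi e ∧ Mono m ∧ e ≫ m = θ ∧ I = image θ :=
    ⟨image θ, factorThruImage θ, image.ι θ, inferInstance, inferInstance, image.fac θ, rfl⟩
  rw [← hIdim] at hmin
  have hIz : ¬ IsZero I := by
    intro h
    apply hθ.1
    rw [← hem, h.eq_of_src m 0, comp_zero]
  have hIfd : FD I := FD_mono m hV
  have key : ∀ (Z : Paths Q ⥤ ModuleCat.{0} k) (l : I ⟶ Z) (y : Z ⟶ V), Mono y →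
      P (e ≫ l ≫ y) → Mono l := by
    intro Z l y hy hPl
    have h1 := hmin _ hPl
    have h2 : tot (image (e ≫ l ≫ y)) ≤ tot (image l) :=
      tot_image_le hV (e ≫ factorThruImage l) (image.ι l ≫ y) (by simp)
    have := iso_of_epi (factorThruImage l) hIfd (h1.trans h2)
    rw [← image.fac l]
    exact mono_comp _ _
  have hsq : θ ≫ θ = 0 := by
    by_contra h
    have hne : ¬ IsIso (θ ≫ θ) := by
      intro h'
      have h1 : Epi θ := epi_of_epi θ θ
      exact hθ.2 (iso_of_epi θ hV le_rfl)
    have e1 : e ≫ (m ≫ e) ≫ m = θ ≫ θ := by rw [← hem]; simp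
    have h2 : Mono (m ≫ e) := key I (m ≫ e) m hm ⟨by rwa [e1], by rwa [e1]⟩
    have h3 : IsIso (m ≫ e) := iso_of_mono (m ≫ e) hIfd le_rfl
    have h4 : IsIso m := retract_iso hI m (e ≫ inv (m ≫ e)) (by
      rw [← Category.assoc, IsIso.hom_inv_id]) hIz
    have h5 : Epi θ := by rw [← hem]; exact epi_comp _ _
    exact hθ.2 (iso_of_epi θ hV le_rfl)
  have hmθ : m ≫ θ = 0 := by
    rw [← cancel_epi e, ← Category.assoc, hem, hsq, comp_zero]
  let κ := kernel.ι θ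
  have hκ : ¬ Epi κ := by
    intro h
    apply hθ.1
    rw [← cancel_epi κ, kernel.condition, comp_zero]
  have hKfd : FD (kernel θ) := FD_mono κ hV
  obtain ⟨J, _, f, i, π, h1, h2, h3, h4⟩ := hasDec _ (kernel θ) hKfd rfl
  let l : I ⟶ kernel θ := kernel.lift θ m hmθ
  have hl : l ≫ κ = m := kernel.lift_ι _ _ _
  have hl0 : l ≠ 0 := by
    intro h
    apply hθ.1
    rw [← hem, ← hl, h, zero_comp, comp_zero]
  obtain ⟨j, hj⟩ : ∃ j, l ≫ π j ≠ 0 := by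
    by_contra h
    apply hl0
    rw [← Category.comp_id l, ← h4, Preadditive.comp_sum]
    refine Finset.sum_eq_zero fun j _ => ?_
    have : l ≫ π j = 0 := by
      by_contra h'
      exact h ⟨j, h'⟩
    rw [← Category.assoc, this, zero_comp]
  have hij : Mono (i j) := mono_of_mono_fac (h2 j)
  have hiκ : ¬ Epi (i j ≫ κ) := fun h => hκ (epi_of_epi (i j) κ)
  have hy : Mono (i j ≫ κ) := mono_comp _ _
  have hlπ : Mono (l ≫ π j) := by
    refine key (f j) (l ≫ π j) (i j ≫ κ) hy ⟨?_, ?_⟩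
    · intro h
      apply hj
      rw [← cancel_epi e, ← cancel_mono (i j ≫ κ), Category.assoc, h]
      simp
    · intro h
      rw [← Category.assoc] at h
      exact hiκ (epi_of_epi (e ≫ l ≫ π j) (i j ≫ κ))
  have w : κ ≫ e = 0 := by
    rw [← cancel_mono m, Category.assoc, hem, kernel.condition, zero_comp]
  have hS : (ShortComplex.mk κ e w).ShortExact := by
    refine { exact := ?_, mono_f := inferInstanceAs (Mono κ), epi_g := he }
    apply ShortComplex.exact_of_f_is_kernel
    refine KernelFork.IsLimit.ofι' κ w (fun {A} x hx => ⟨kernel.lift θ x ?_, kernel.lift_ι _ _ _⟩)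
    rw [← hem, ← Category.assoc, hx, zero_comp]
  have hnE : ¬ E0 I (f j) := by
    intro hE
    obtain ⟨ρ, hρ⟩ := extend_along κ e w hS hE (π j)
    have := retract_iso hI (i j ≫ κ) ρ (by rw [Category.assoc, hρ, h2]) (h1 j).1
    exact hiκ inferInstance
  have hfd : FD (f j) := FD_mono (i j ≫ κ) hV
  have hlt : tot (f j) < n := by
    by_contra h
    have := iso_of_mono (i j ≫ κ) hV (by omega)
    exact hiκ inferInstance
  have hbr := ih _ hlt (f j) hfd (h1 j) rfl
  have hr := finrank_of_brick hfd (h1 j).1 hbr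
  have hE : E0 (f j) (f j) := E0_of_Eu hfd hfd (by rw [hr]; norm_num)
    (hdynkin _ (dimv_ne_zero hfd (h1 j).1))
  exact hnE (E0_mono (f := l ≫ π j) hE)

theorem indec_facts [IsAlgClosed k] (hdynkin : ∀ x : Q → ℚ, x ≠ 0 → 0 < Eu x x)
    (hV : FD V) (hI : Indec V) :
    Brick V ∧ Module.finrank k (V ⟶ V) = 1 ∧ EndK V ∧ E0 V V := by
  have hb := brick_of_indec hdynkin _ V hV hI rfl
  have hr := finrank_of_brick hV hI.1 hb
  exact ⟨hb, hr, endK_of_finrank hI.1 hr, E0_of_Eu hV hV (by rw [hr]; norm_num)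
    (hdynkin _ (dimv_ne_zero hV hI.1))⟩

end part4

section part5

variable {k : Type} [Field k] {Q : Type} [Quiver.{1} Q]
variable {T U V W : Paths Q ⥤ ModuleCat.{0} k}

theorem ses_desc {A B C Z : Paths Q ⥤ ModuleCat.{0} k} (i : A ⟶ B) (p : B ⟶ C) (w : i ≫ p = 0)
    (h : (ShortComplex.mk i p w).ShortExact) (g : B ⟶ Z) (hg : i ≫ g = 0) :
    ∃ u : C ⟶ Z, g = p ≫ u := by
  have : Epi (ShortComplex.mk i p w).g := h.epi_g
  exact ⟨h.exact.desc g hg, (h.exact.g_desc g hg).symm⟩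

theorem ses_lift {A B C Z : Paths Q ⥤ ModuleCat.{0} k} (i : A ⟶ B) (p : B ⟶ C) (w : i ≫ p = 0)
    (h : (ShortComplex.mk i p w).ShortExact) (g : Z ⟶ B) (hg : g ≫ p = 0) :
    ∃ u : Z ⟶ A, g = u ≫ i := by
  have : Mono (ShortComplex.mk i p w).f := h.mono_f
  exact ⟨h.exact.lift g hg, (h.exact.lift_f g hg).symm⟩

theorem split_of_section {A B C : Paths Q ⥤ ModuleCat.{0} k} (i : A ⟶ B) (p : B ⟶ C)
    (w : i ≫ p = 0) (h : (ShortComplex.mk i p w).ShortExact) (s : C ⟶ B) (hs : s ≫ p = 𝟙 C) :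
    ∃ r : B ⟶ A, i ≫ r = 𝟙 A := by
  obtain ⟨r, hr⟩ := ses_lift i p w h (𝟙 B - p ≫ s) (by
    rw [Preadditive.sub_comp, Category.assoc, hs]; simp)
  have : Mono i := h.mono_f
  refine ⟨r, ?_⟩
  rw [← cancel_mono i, Category.assoc, ← hr, Preadditive.comp_sub, ← Category.assoc, w]
  simp

theorem E0_of_dim {M S X : Paths Q ⥤ ModuleCat.{0} k} (ι : S ⟶ X) (p : X ⟶ M)
    (hdim : ∀ (X' : Paths Q ⥤ ModuleCat.{0} k) (ι' : S ⟶ X') (p' : X' ⟶ M)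
        (w' : ι' ≫ p' = 0), (ShortComplex.mk ι' p' w').ShortExact →
        (¬ ∃ r : X' ⟶ S, ι' ≫ r = 𝟙 S) →
        ∃ (c : k) (φ : X ≅ X'), c ≠ 0 ∧ ι ≫ φ.hom = c • ι' ∧ φ.hom ≫ p' = p) (c : C1 M S) :
    (∃ φ, dd M X φ = rc c (fam ι)) ∧ (∃ φ, dd X S φ = lc (fam p) c) := by
  by_cases hc : ∃ φ, dd M S φ = c
  · obtain ⟨φ, rfl⟩ := hc
    exact ⟨⟨cc φ (fam ι), dd_cc_fam _ _⟩, ⟨cc (fam p) φ, dd_fam_cc _ _⟩⟩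
  · obtain ⟨E, i, p', w', s, r, hS, hs, hr⟩ := exists_ext c
    have hns : ¬ ∃ r : E ⟶ S, i ≫ r = 𝟙 S := by
      rintro ⟨r0, hr0⟩
      refine hc ⟨cc s (fam r0), ?_⟩
      rw [dd_cc_fam, hs, rc_assoc, ← fam_comp, hr0, fam_id, rc_one]
    obtain ⟨c0, φ, hc0, h1, h2⟩ := hdim E i p' w' hS hns
    have h1' : ι = c0 • (i ≫ φ.inv) := by
      rw [← Linear.smul_comp, ← h1, Category.assoc, φ.hom_inv_id, Category.comp_id]
    refine ⟨⟨c0 • cc s (fam φ.inv), ?_⟩, ⟨-cc (fam φ.hom) r, ?_⟩⟩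
    · rw [map_smul, dd_cc_fam, hs, rc_assoc, ← fam_comp, ← rc_smul, ← fam_smul, ← h1']
    · have : lc (fam φ.hom) (-lc (fam p') c) = - lc (fam φ.hom) (lc (fam p') c) := by
        funext a b α; simp [lc]
      rw [map_neg, dd_fam_cc, hr, this, neg_neg, ← lc_assoc, ← fam_comp, h2]

theorem exists_ne_comp {X Y Z : Paths Q ⥤ ModuleCat.{0} k} {J : Type} [Fintype J]
    {f : J → (Paths Q ⥤ ModuleCat.{0} k)} {i : ∀ j, f j ⟶ X} {π : ∀ j, X ⟶ f j}
    (h : ∑ j, π j ≫ i j = 𝟙 X) (a : Y ⟶ X) (b : X ⟶ Z) (hab : a ≫ b ≠ 0) :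
    ∃ j, a ≫ π j ≫ i j ≫ b ≠ 0 := by
  by_contra hcon
  apply hab
  have e : a ≫ b = ∑ j, a ≫ π j ≫ i j ≫ b := by
    have := congrArg (fun y => a ≫ y ≫ b) h
    simpa [Preadditive.sum_comp, Preadditive.comp_sum] using this.symm
  rw [e]
  refine Finset.sum_eq_zero fun j _ => ?_
  by_contra h'
  exact hcon ⟨j, h'⟩

theorem iso_biproduct {X : Paths Q ⥤ ModuleCat.{0} k} {m : ℕ}
    {f : Fin m → (Paths Q ⥤ ModuleCat.{0} k)} (i : ∀ j, f j ⟶ X) (π : ∀ j, X ⟶ f j)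
    (h1 : ∀ j, i j ≫ π j = 𝟙 _) (h2 : ∀ j l, j ≠ l → i j ≫ π l = 0)
    (h : ∑ j, π j ≫ i j = 𝟙 X) : Nonempty (X ≅ biproduct f) := by
  let b : Bicone f :=
    { pt := X
      π := π
      ι := i
      ι_π := fun j l => by
        by_cases hjl : j = l
        · subst hjl; simp [h1]
        · rw [dif_neg hjl]; exact h2 j l hjl }
  exact ⟨biproduct.uniqueUpToIso f (b := b) (isBilimitOfTotal b h)⟩

variable [Fintype Q] [∀ a b : Q, Fintype (a ⟶ b)]

theorem main [IsAlgClosed k] (hdynkin : ∀ x : Q → ℚ, x ≠ 0 → 0 < Eu x x)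
    (M S : Paths Q ⥤ ModuleCat.{0} k) (hMfd : FD M) (hSfd : FD S)
    (hMind : Indec M) (hSind : Indec S) (hSM : E0 S M)
    (X : Paths Q ⥤ ModuleCat.{0} k) (ι : S ⟶ X) (p : X ⟶ M) (w : ι ≫ p = 0)
    (hSE : (ShortComplex.mk ι p w).ShortExact)
    (hnonsplit : ¬ ∃ r : X ⟶ S, ι ≫ r = 𝟙 S)
    (hdim : ∀ (X' : Paths Q ⥤ ModuleCat.{0} k) (ι' : S ⟶ X') (p' : X' ⟶ M)
        (w' : ι' ≫ p' = 0), (ShortComplex.mk ι' p' w').ShortExact →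
        (¬ ∃ r : X' ⟶ S, ι' ≫ r = 𝟙 S) →
        ∃ (c : k) (φ : X ≅ X'), c ≠ 0 ∧ ι ≫ φ.hom = c • ι' ∧ φ.hom ≫ p' = p) :
    ∃ (m : ℕ) (f : Fin m → (Paths Q ⥤ ModuleCat.{0} k)),
      (∀ i, Indec (f i) ∧ FD (f i) ∧
        (∃ g : S ⟶ f i, g ≠ 0) ∧ (∃ g : f i ⟶ M, g ≠ 0) ∧
        E0 (f i) S ∧ E0 M (f i)) ∧
      (∀ i j, i ≠ j → ¬ Nonempty (f i ≅ f j)) ∧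
      (∀ V : Paths Q ⥤ ModuleCat.{0} k,
        Indec V → FD V →
        (∃ g : S ⟶ V, g ≠ 0) → (∃ g : V ⟶ M, g ≠ 0) →
        E0 V S → E0 M V → ∃ i, Nonempty (V ≅ f i)) ∧
      Nonempty (X ≅ biproduct f) := by
  have hιm : Mono ι := hSE.mono_f
  have hpe : Epi p := hSE.epi_g
  obtain ⟨hMb, hM1, hMK, hMM⟩ := indec_facts hdynkin hMfd hMind
  obtain ⟨hSb, hS1, hSK, hSS⟩ := indec_facts hdynkin hSfd hSind
  have hMS : ¬ E0 M S := fun h => hnonsplit (extend_along ι p w hSE h (𝟙 S))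
  have hXfd : FD X := FD_mid ι p w hSE hSfd hMfd
  have homMS : ∀ f : M ⟶ S, f = 0 := by
    intro f
    by_contra hf
    rcases happel_ringel hMK hSK hSM f hf with h | h
    · exact hMS (E0_mono (f := f) hSS)
    · exact hMS (E0_epi (f := f) hMM)
  have hMX : E0 M X := E0_mid_right ι p w hSE hMM fun c => (E0_of_dim ι p hdim c).1
  have hXS : E0 X S := E0_mid_left ι p w hSE hSS fun c => (E0_of_dim ι p hdim c).2
  have hSX : E0 S X := E0_mid_right ι p w hSE hSM fun c => by
    obtain ⟨φ, rfl⟩ := hSS c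
    exact ⟨cc φ (fam ι), dd_cc_fam _ _⟩
  have homMX : ∀ u : M ⟶ X, u = 0 := by
    intro u
    obtain ⟨c, hc⟩ := hMK (u ≫ p)
    by_cases h0 : c = 0
    · rw [h0, zero_smul] at hc
      obtain ⟨v, hv⟩ := ses_lift ι p w hSE u hc
      rw [hv, homMS v, zero_comp]
    · exact absurd (split_of_section ι p w hSE (c⁻¹ • u) (by
        rw [Linear.smul_comp, hc, smul_smul, inv_mul_cancel₀ h0, one_smul])) hnonsplit
  have homXX : ∀ e : X ⟶ X, ι ≫ e = 0 → e = 0 := by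
    intro e he
    obtain ⟨u, hu⟩ := ses_desc ι p w hSE e he
    rw [hu, homMX u, comp_zero]
  obtain ⟨J, _, f', i', π', d1', d2', d3', d4'⟩ := hasDec _ X hXfd rfl
  let e := Fintype.equivFin J
  obtain ⟨m, f, i, π, d1, d2, d3, d4⟩ : ∃ (m : ℕ) (f : Fin m → (Paths Q ⥤ ModuleCat.{0} k))
      (i : ∀ j, f j ⟶ X) (π : ∀ j, X ⟶ f j), (∀ j, Indec (f j)) ∧ (∀ j, i j ≫ π j = 𝟙 _) ∧
      (∀ j l, j ≠ l → i j ≫ π l = 0) ∧ ∑ j, π j ≫ i j = 𝟙 X := by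
    refine ⟨_, fun j => f' (e.symm j), fun j => i' _, fun j => π' _, fun j => d1' _,
      fun j => d2' _, fun j l h => d3' _ _ (fun h' => h (e.symm.injective h')), ?_⟩
    rw [← d4']
    exact Equiv.sum_comp e.symm (fun j => π' j ≫ i' j)
  have him : ∀ j, Mono (i j) := fun j => mono_of_mono_fac (d2 j)
  have hπe : ∀ j, Epi (π j) := fun j => epi_of_epi_fac (d2 j)
  have hfd : ∀ j, FD (f j) := fun j => FD_mono (i j) hXfd
  have hfacts := fun j => indec_facts hdynkin (hfd j) (d1 j)
  have hid : ∀ j, 𝟙 (f j) ≠ 0 := fun j h => (d1 j).1 ((IsZero.iff_id_eq_zero _).2 h)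
  have hιπ : ∀ j, ι ≫ π j ≠ 0 := by
    intro j h
    have h1 := homXX (π j ≫ i j) (by rw [← Category.assoc, h, zero_comp])
    apply hid j
    have h2 : π j = 0 := by rw [← cancel_mono (i j), h1, zero_comp]
    rw [← d2 j, h2, comp_zero]
  have hip : ∀ j, i j ≫ p ≠ 0 := by
    intro j h
    obtain ⟨v, hv⟩ := ses_lift ι p w hSE (i j) h
    have h1 : v ≫ ι ≫ π j = 𝟙 _ := by rw [← Category.assoc, ← hv, d2]
    rcases hSb (ι ≫ π j ≫ v) with h2 | h2
    · apply hid j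
      have : v ≫ (ι ≫ π j ≫ v) ≫ ι ≫ π j = 𝟙 _ := by
        have : v ≫ (ι ≫ π j ≫ v) ≫ ι ≫ π j = (v ≫ ι ≫ π j) ≫ (v ≫ ι ≫ π j) := by simp
        rw [this, h1, Category.comp_id]
      rw [← this, h2, zero_comp, comp_zero]
    · exact hnonsplit ⟨(π j ≫ v) ≫ inv (ι ≫ π j ≫ v), by
        rw [← Category.assoc, IsIso.hom_inv_id]⟩
  have hfS : ∀ j, E0 (f j) S := fun j => E0_mono (f := i j) hXS
  have hMf : ∀ j, E0 M (f j) := fun j => E0_epi (f := π j) hMX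
  have hSf : ∀ j, E0 S (f j) := fun j => E0_epi (f := π j) hSX
  have hhom : ∀ j, Module.finrank k (S ⟶ f j) ≤ 1 := fun j =>
    hom_le_one hdynkin hSfd (hfd j) hS1 (hfacts j).2.1 hSS (hfacts j).2.2.2 (hSf j) (hfS j)
  have orth : ∀ j l, j ≠ l → ∀ η : f j ⟶ f l, η = 0 := by
    intro j l hjl η
    have := fd_Hom hSfd (hfd l)
    obtain ⟨v, hv⟩ := finrank_le_one_iff.1 (hhom l)
    obtain ⟨a, ha⟩ := hv (ι ≫ π j ≫ η)
    obtain ⟨b, hb⟩ := hv (ι ≫ π l)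
    have hb0 : b ≠ 0 := by
      rintro rfl
      exact hιπ l (by rw [← hb, zero_smul])
    have hv' : v = b⁻¹ • (ι ≫ π l) := by
      rw [← hb, smul_smul, inv_mul_cancel₀ hb0, one_smul]
    have h1 := homXX (π j ≫ η ≫ i l - (a * b⁻¹) • (π l ≫ i l)) (by
      rw [Preadditive.comp_sub, Linear.comp_smul]
      have e1 : ι ≫ π j ≫ η ≫ i l = (ι ≫ π j ≫ η) ≫ i l := by simp
      rw [e1, ← ha, hv', smul_smul, Linear.smul_comp, Category.assoc, sub_self])
    have h2 := congrArg (fun y => i j ≫ y ≫ π l) (sub_eq_zero.1 h1)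
    have e2 : i j ≫ (π j ≫ η ≫ i l) ≫ π l = (i j ≫ π j) ≫ η ≫ (i l ≫ π l) := by simp
    have e3 : i j ≫ ((a * b⁻¹) • (π l ≫ i l)) ≫ π l = (a * b⁻¹) • ((i j ≫ π l) ≫ i l ≫ π l) := by
      simp
    rw [e2, e3, d2, d2, d3 j l hjl] at h2
    simpa using h2
  refine ⟨m, f, fun j => ⟨d1 j, hfd j, ⟨_, hιπ j⟩, ⟨_, hip j⟩, hfS j, hMf j⟩, ?_, ?_,
    iso_biproduct i π d2 d3 d4⟩
  · rintro j l hjl ⟨φ⟩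
    apply hid j
    rw [← φ.hom_inv_id, orth j l hjl φ.hom, zero_comp]
  · rintro V hVI hVfd ⟨g, hg⟩ ⟨h, hh⟩ hVS hMV
    obtain ⟨hVb, hV1, hVK, hVV⟩ := indec_facts hdynkin hVfd hVI
    obtain ⟨g1, hg1⟩ := extend_along ι p w hSE hMV g
    obtain ⟨h1, hh1⟩ := lift_along ι p w hSE hVS h
    obtain ⟨j, hj⟩ := exists_ne_comp d4 ι g1 (by rwa [hg1])
    obtain ⟨l, hl⟩ := exists_ne_comp d4 h1 p (by rwa [hh1])
    obtain ⟨x, hx⟩ : ∃ x, x = i j ≫ g1 := ⟨_, rfl⟩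
    obtain ⟨y, hy⟩ : ∃ y, y = h1 ≫ π l := ⟨_, rfl⟩
    have hj' : (ι ≫ π j) ≫ x ≠ 0 := by rw [hx]; simpa using hj
    have hl' : y ≫ i l ≫ p ≠ 0 := by rw [hy]; simpa using hl
    have hx0 : x ≠ 0 := by rintro h0; rw [h0, comp_zero] at hj'; exact hj' rfl
    by_cases hxy : x ≫ y = 0
    · -- hard case
      have hgh : ((ι ≫ π j) ≫ x) ≫ (y ≫ i l ≫ p) = 0 := by
        have : ((ι ≫ π j) ≫ x) ≫ (y ≫ i l ≫ p) = ι ≫ π j ≫ (x ≫ y) ≫ i l ≫ p := by simp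
        rw [this, hxy, zero_comp, comp_zero, comp_zero]
      have hgm : Mono ((ι ≫ π j) ≫ x) := by
        refine (happel_ringel hSK hVK hVS _ hj').resolve_right fun h => hl' ?_
        rw [← cancel_epi ((ι ≫ π j) ≫ x), hgh, comp_zero]
      have hhe : Epi (y ≫ i l ≫ p) := by
        refine (happel_ringel hVK hMK hMV _ hl').resolve_left fun h => hj' ?_
        rw [← cancel_mono (y ≫ i l ≫ p), hgh, zero_comp]
      have hm : Mono (ι ≫ π j) := mono_of_mono _ x
      have he : Epi (i l ≫ p) := epi_of_epi y _
      by_cases hjl : j = l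
      · subst hjl
        have hVM : E0 V M := E0_epi (f := y ≫ i j ≫ p) hVV
        have hVX : E0 V X := E0_mid_right ι p w hSE hVM fun c => by
          obtain ⟨φ, rfl⟩ := hVS c
          exact ⟨cc φ (fam ι), dd_cc_fam _ _⟩
        have hSV : E0 S V := E0_mono (f := (ι ≫ π j) ≫ x) hVV
        have hXV : E0 X V := E0_mid_left ι p w hSE hSV fun c => by
          obtain ⟨φ, rfl⟩ := hMV c
          exact ⟨cc (fam p) φ, dd_fam_cc _ _⟩
        have hVf : E0 V (f j) := E0_epi (f := π j) hVX
        have hfV : E0 (f j) V := E0_mono (f := i j) hXV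
        have hy0 : y ≠ 0 := by rintro h0; rw [h0, zero_comp] at hl'; exact hl' rfl
        have hxm : Mono x := (happel_ringel (hfacts j).2.2.1 hVK hVf x hx0).resolve_right
          fun h => hy0 (by rw [← cancel_epi x, hxy, comp_zero])
        have hye : Epi y := (happel_ringel hVK (hfacts j).2.2.1 hfV y hy0).resolve_left
          fun h => hx0 (by rw [← cancel_mono y, hxy, zero_comp])
        rcases hVb (y ≫ x) with h0 | h0
        · exact absurd (by rw [← cancel_epi y, h0, comp_zero]) hx0
        · have : Mono y := mono_of_mono y x
          have : IsIso y := isIso_of_mono_of_epi y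
          exact ⟨j, ⟨asIso y⟩⟩
      · exfalso
        have hep : Epi (ι ≫ π j) := by
          refine Preadditive.epi_of_cancel_zero _ fun {Z} z hz => ?_
          obtain ⟨u, hu⟩ := ses_desc ι p w hSE (π j ≫ z) (by rw [← Category.assoc, hz])
          have h2 : (i l ≫ p) ≫ u = 0 := by
            rw [Category.assoc, ← hu, ← Category.assoc, d3 l j (Ne.symm hjl), zero_comp]
          have h3 : u = 0 := by rw [← cancel_epi (i l ≫ p), h2, comp_zero]
          rw [← cancel_epi (π j), hu, h3, comp_zero, comp_zero]
        have : IsIso (ι ≫ π j) := isIso_of_mono_of_epi _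
        exact hnonsplit ⟨π j ≫ inv (ι ≫ π j), by rw [← Category.assoc, IsIso.hom_inv_id]⟩
    · by_cases hjl : j = l
      · subst hjl
        have : IsIso (x ≫ y) := ((hfacts j).1 (x ≫ y)).resolve_left hxy
        have : IsIso x := retract_iso hVI x (y ≫ inv (x ≫ y)) (by
          rw [← Category.assoc, IsIso.hom_inv_id]) (d1 j).1
        exact ⟨j, ⟨(asIso x).symm⟩⟩
      · exact absurd (orth j l hjl _) hxy

end part5

end DynkinMid

/-- Let `Q` be a simply-laced Dynkin quiver, and let `M, M*` be
indecomposable `kQ`-modules with `dim_k Ext¹_{kQ}(M, M*) = 1` and `Ext¹_{kQ}(M*, M) = 0`.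
Let `0 → M* → X → M → 0` be the (unique up to isomorphism) non-split extension.  Then `X`
is the direct sum, each with multiplicity one, of all indecomposable `kQ`-modules `V`
satisfying `Hom(M*, V) ≠ 0`, `Hom(V, M) ≠ 0`, `Ext¹(V, M*) = 0` and `Ext¹(M, V) = 0`.
Here `kQ`-modules are realised as representations `Paths Q ⥤ ModuleCat k`, and
`dim_k Ext¹_{kQ}(M,M*) = 1` is expressed by the existence of the given non-split extension
together with the fact that every non-split extension of `M` by `M*` is isomorphic to a
nonzero scalar multiple of it. -/
theorem middle_term_of_unique_nonsplit_extension
    (k : Type) [Field k] [IsAlgClosed k]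
    -- a finite quiver Q:
    (Q : Type) [Quiver.{1} Q] [Fintype Q] [∀ a b : Q, Fintype (a ⟶ b)]
    -- whose underlying graph is connected ...
    (hconn : ∀ a b : Quiver.Symmetrify Q, Nonempty (Quiver.Path a b))
    -- ... and is a simply-laced Dynkin diagram (positive definite Tits form):
    (hdynkin : ∀ x : Q → ℚ, x ≠ 0 →
      0 < (∑ a : Q, x a * x a) -
        ∑ a : Q, ∑ b : Q, (Fintype.card (a ⟶ b) : ℚ) * (x a * x b))
    -- M and M* are finite-dimensional indecomposable representations of Q:
    (M Mstar : Paths Q ⥤ ModuleCat.{0} k)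
    (hMfd : ∀ q : Paths Q, FiniteDimensional k (M.obj q))
    (hMstarfd : ∀ q : Paths Q, FiniteDimensional k (Mstar.obj q))
    (hMind : Indec M) (hMstarind : Indec Mstar)
    -- Ext¹_{kQ}(M*, M) = 0:
    (hext0 : Ext1Zero Mstar M)
    -- the non-split extension 0 → M* → X → M → 0:
    (X : Paths Q ⥤ ModuleCat.{0} k) (ι : Mstar ⟶ X) (p : X ⟶ M) (w : ι ≫ p = 0)
    (hSE : (ShortComplex.mk ι p w).ShortExact)
    (hnonsplit : ¬ ∃ r : X ⟶ Mstar, ι ≫ r = 𝟙 Mstar)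
    -- dim_k Ext¹_{kQ}(M, M*) = 1: every non-split extension of M by M* is equivalent to a
    -- nonzero scalar multiple of the one above:
    (hdim : ∀ (X' : Paths Q ⥤ ModuleCat.{0} k) (ι' : Mstar ⟶ X') (p' : X' ⟶ M)
        (w' : ι' ≫ p' = 0), (ShortComplex.mk ι' p' w').ShortExact →
        (¬ ∃ r : X' ⟶ Mstar, ι' ≫ r = 𝟙 Mstar) →
        ∃ (c : k) (φ : X ≅ X'), c ≠ 0 ∧ ι ≫ φ.hom = c • ι' ∧ φ.hom ≫ p' = p) :
    -- conclusion: X is the multiplicity-one direct sum of all indecomposable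
    -- finite-dimensional representations V with Hom(M*,V) ≠ 0, Hom(V,M) ≠ 0,
    -- Ext¹(V,M*) = 0 and Ext¹(M,V) = 0:
    ∃ (m : ℕ) (f : Fin m → (Paths Q ⥤ ModuleCat.{0} k)),
      (∀ i, Indec (f i) ∧ (∀ q : Paths Q, FiniteDimensional k ((f i).obj q)) ∧
        (∃ g : Mstar ⟶ f i, g ≠ 0) ∧ (∃ g : f i ⟶ M, g ≠ 0) ∧
        Ext1Zero (f i) Mstar ∧ Ext1Zero M (f i)) ∧
      (∀ i j, i ≠ j → ¬ Nonempty (f i ≅ f j)) ∧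
      (∀ V : Paths Q ⥤ ModuleCat.{0} k,
        Indec V → (∀ q : Paths Q, FiniteDimensional k (V.obj q)) →
        (∃ g : Mstar ⟶ V, g ≠ 0) → (∃ g : V ⟶ M, g ≠ 0) →
        Ext1Zero V Mstar → Ext1Zero M V → ∃ i, Nonempty (V ≅ f i)) ∧
      Nonempty (X ≅ biproduct f) := by
  obtain ⟨m, f, h1, h2, h3, h4⟩ := DynkinMid.main hdynkin M Mstar hMfd hMstarfd hMind hMstarind
    (DynkinMid.E0_of_ext1Zero hext0) X ι p w hSE hnonsplit hdim
  refine ⟨m, f, fun i => ?_, h2, fun V hV hVfd hg hh hE hE' => ?_, h4⟩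
  · obtain ⟨a1, a2, a3, a4, a5, a6⟩ := h1 i
    exact ⟨a1, a2, a3, a4, DynkinMid.ext1Zero_of_E0 a5, DynkinMid.ext1Zero_of_E0 a6⟩
  · exact h3 V hV hVfd hg hh (DynkinMid.E0_of_ext1Zero hE) (DynkinMid.E0_of_ext1Zero hE')
end
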